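/- Assume u, v, f ∈ C(ℝⁿ), f ≥ 0, and α ∈ ℝ satisfy, in the viscosity sense, F(D²u) − (1/2) y·Du − αu ≤ f in ℝⁿ and f ≤ F(D²v) − (1/2) y·Dv − αv in ℝⁿ. Suppose also that v > 0 everywhere and that u(y) ≤ C exp(−a|y|^p) for some constants C, a > 0 and p > 1 and every y ∈ ℝⁿ. Then either u ≤ v in ℝⁿ, or u ≡ tv for some constant t > 1. -/

import Mathlib

noncomputable section

open Filter Matrix Real Set
open scoped Topology

/-- Euclidean `n`-space `ℝⁿ`. -/
abbrev En (n : ℕ) := EuclideanSpace ℝ (Fin n)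

/-- `n × n` real matrices. -/
abbrev Mat (n : ℕ) := Matrix (Fin n) (Fin n) ℝ

/-- The set of symmetric positive definite matrices whose eigenvalues all lie in `[lam, Lam]`. -/
def PucciMatrices (n : ℕ) (lam Lam : ℝ) : Set (Mat n) :=
  { A | ∃ hA : A.IsHermitian, ∀ i, hA.eigenvalues i ∈ Set.Icc lam Lam }

/-- The Pucci maximal operator `P⁺(M) = sup {-tr(AM) : A ∈ PucciMatrices}`. -/
def PucciPlus (n : ℕ) (lam Lam : ℝ) (M : Mat n) : ℝ :=
  sSup ((fun A => -(A * M).trace) '' PucciMatrices n lam Lam)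

/-- The Pucci minimal operator `P⁻(M) = inf {-tr(AM) : A ∈ PucciMatrices}`. -/
def PucciMinus (n : ℕ) (lam Lam : ℝ) (M : Mat n) : ℝ :=
  sInf ((fun A => -(A * M).trace) '' PucciMatrices n lam Lam)

/-- `F` is uniformly elliptic with ellipticity constants `lam ≤ Lam`. -/
def UniformlyElliptic (n : ℕ) (lam Lam : ℝ) (F : Mat n → ℝ) : Prop :=
  ∀ M N : Mat n, M.IsSymm → N.IsSymm →
    PucciMinus n lam Lam (M - N) ≤ F M - F N ∧ F M - F N ≤ PucciPlus n lam Lam (M - N)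

/-- `F` is positively homogeneous of order one. -/
def PositivelyHomogeneous (n : ℕ) (F : Mat n → ℝ) : Prop :=
  ∀ (M : Mat n), ∀ η : ℝ, 0 ≤ η → F (η • M) = η * F M

/-- The Hessian matrix of `φ : ℝⁿ → ℝ` at a point `y`. -/
def hess (n : ℕ) (φ : En n → ℝ) (y : En n) : Mat n :=
  Matrix.of fun i j =>
    fderiv ℝ (fun z => fderiv ℝ φ z (EuclideanSpace.single j 1)) y (EuclideanSpace.single i 1)

/-- Viscosity subsolution of the elliptic equation `G(D²u, Du, u, y) = 0` on `Ω`,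
i.e. `G[u] ≤ 0` in the viscosity sense. -/
def ViscSubE (n : ℕ) (Ω : Set (En n))
    (G : Mat n → (En n →L[ℝ] ℝ) → ℝ → En n → ℝ) (u : En n → ℝ) : Prop :=
  ∀ y ∈ Ω, ∀ φ : En n → ℝ, ContDiff ℝ 2 φ →
    IsLocalMaxOn (fun z => u z - φ z) Ω y →
    G (hess n φ y) (fderiv ℝ φ y) (u y) y ≤ 0

/-- Viscosity supersolution of the elliptic equation `G(D²u, Du, u, y) = 0` on `Ω`,
i.e. `G[u] ≥ 0` in the viscosity sense. -/
def ViscSupE (n : ℕ) (Ω : Set (En n))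
    (G : Mat n → (En n →L[ℝ] ℝ) → ℝ → En n → ℝ) (u : En n → ℝ) : Prop :=
  ∀ y ∈ Ω, ∀ φ : En n → ℝ, ContDiff ℝ 2 φ →
    IsLocalMinOn (fun z => u z - φ z) Ω y →
    0 ≤ G (hess n φ y) (fderiv ℝ φ y) (u y) y

/-- Viscosity solution of the elliptic equation `G(D²u, Du, u, y) = 0` on `Ω`. -/
def ViscSolE (n : ℕ) (Ω : Set (En n))
    (G : Mat n → (En n →L[ℝ] ℝ) → ℝ → En n → ℝ) (u : En n → ℝ) : Prop :=
  ViscSubE n Ω G u ∧ ViscSupE n Ω G u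

/-- Time derivative of `φ : ℝⁿ × ℝ → ℝ` at `p = (x, t)`. -/
def tderiv (n : ℕ) (φ : En n × ℝ → ℝ) (p : En n × ℝ) : ℝ :=
  deriv (fun s => φ (p.1, s)) p.2

/-- Spatial Hessian of `φ : ℝⁿ × ℝ → ℝ` at `p = (x, t)`. -/
def shess (n : ℕ) (φ : En n × ℝ → ℝ) (p : En n × ℝ) : Mat n :=
  hess n (fun z => φ (z, p.2)) p.1

/-- Spatial differential of `φ : ℝⁿ × ℝ → ℝ` at `p = (x, t)`. -/
def sgrad (n : ℕ) (φ : En n × ℝ → ℝ) (p : En n × ℝ) : En n →L[ℝ] ℝ :=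
  fderiv ℝ (fun z => φ (z, p.2)) p.1

/-- Viscosity subsolution of the parabolic equation `u_t + G(D²u, Du, u, (x,t)) = 0` on `Ω`. -/
def ViscSubP (n : ℕ) (Ω : Set (En n × ℝ))
    (G : Mat n → (En n →L[ℝ] ℝ) → ℝ → En n × ℝ → ℝ) (u : En n × ℝ → ℝ) : Prop :=
  ∀ p ∈ Ω, ∀ φ : En n × ℝ → ℝ, ContDiff ℝ 2 φ →
    IsLocalMaxOn (fun q => u q - φ q) Ω p →
    tderiv n φ p + G (shess n φ p) (sgrad n φ p) (u p) p ≤ 0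

/-- Viscosity supersolution of the parabolic equation `u_t + G(D²u, Du, u, (x,t)) = 0` on `Ω`. -/
def ViscSupP (n : ℕ) (Ω : Set (En n × ℝ))
    (G : Mat n → (En n →L[ℝ] ℝ) → ℝ → En n × ℝ → ℝ) (u : En n × ℝ → ℝ) : Prop :=
  ∀ p ∈ Ω, ∀ φ : En n × ℝ → ℝ, ContDiff ℝ 2 φ →
    IsLocalMinOn (fun q => u q - φ q) Ω p →
    0 ≤ tderiv n φ p + G (shess n φ p) (sgrad n φ p) (u p) p

/-- Viscosity solution of the parabolic equation `u_t + G(D²u, Du, u, (x,t)) = 0` on `Ω`. -/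
def ViscSolP (n : ℕ) (Ω : Set (En n × ℝ))
    (G : Mat n → (En n →L[ℝ] ℝ) → ℝ → En n × ℝ → ℝ) (u : En n × ℝ → ℝ) : Prop :=
  ViscSubP n Ω G u ∧ ViscSupP n Ω G u

/-- The parabolic domain `ℝⁿ × ℝ₊`. -/
def Qset (n : ℕ) : Set (En n × ℝ) := {p | 0 < p.2}

/-- The elliptic operator `F(D²u) - (1/2) y·Du - α u - f(y)`. -/
def Fop (n : ℕ) (F : Mat n → ℝ) (α : ℝ) (f : En n → ℝ) :
    Mat n → (En n →L[ℝ] ℝ) → ℝ → En n → ℝ :=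
  fun M p v y => F M - (1/2) * p y - α * v - f y

/-- Membership in the space `X` with weight `b`: continuity and finiteness of the norm. -/
def memX (n : ℕ) (b : ℝ) (u : En n → ℝ) : Prop :=
  Continuous u ∧ BddAbove (Set.range fun y : En n => |u y| * Real.exp (b * ‖y‖ ^ 2) / (1 + ‖y‖ ^ 2))

/-- The norm `‖u‖_X = sup_y |u(y)| e^{b|y|²} / (1 + |y|²)`. -/
def normX (n : ℕ) (b : ℝ) (u : En n → ℝ) : ℝ :=
  sSup (Set.range fun y : En n => |u y| * Real.exp (b * ‖y‖ ^ 2) / (1 + ‖y‖ ^ 2))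

/-- The positive anomalous exponent `α⁺(F)`. -/
def alphaPlus (n : ℕ) (lam Lam : ℝ) (F : Mat n → ℝ) : ℝ :=
  sSup { α : ℝ | ∃ φ : En n → ℝ, memX n (1/(8*Lam)) φ ∧ (∀ y, 0 ≤ φ y) ∧ φ ≠ 0 ∧
    ViscSupE n Set.univ (Fop n F α (fun _ => 0)) φ }

/-- `Φ` is a positive self-similar solution of `u_t + F(D²u) = 0` with exponent `α`,
with a Gaussian upper bound at time one. -/
def IsSelfSimilarPlus (n : ℕ) (F : Mat n → ℝ) (α : ℝ) (Φ : En n × ℝ → ℝ) : Prop :=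
  ContinuousOn Φ (Qset n) ∧
  (∀ p ∈ Qset n, 0 < Φ p) ∧
  ViscSolP n (Qset n) (fun M _ _ _ => F M) Φ ∧
  (∀ σ : ℝ, 0 < σ → ∀ x : En n, ∀ t : ℝ, 0 < t →
    Φ (x, t) = σ ^ α * Φ (Real.sqrt σ • x, σ * t)) ∧
  (∃ C : ℝ, 0 < C ∧ ∃ a : ℝ, 0 < a ∧ ∀ x : En n, Φ (x, 1) ≤ C * Real.exp (-a * ‖x‖ ^ 2))

/-- `Φ` is a negative self-similar solution of `u_t + F(D²u) = 0` with exponent `α`,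
with a Gaussian lower bound at time one. -/
def IsSelfSimilarMinus (n : ℕ) (F : Mat n → ℝ) (α : ℝ) (Φ : En n × ℝ → ℝ) : Prop :=
  ContinuousOn Φ (Qset n) ∧
  (∀ p ∈ Qset n, Φ p < 0) ∧
  ViscSolP n (Qset n) (fun M _ _ _ => F M) Φ ∧
  (∀ σ : ℝ, 0 < σ → ∀ x : En n, ∀ t : ℝ, 0 < t →
    Φ (x, t) = σ ^ α * Φ (Real.sqrt σ • x, σ * t)) ∧
  (∃ C : ℝ, 0 < C ∧ ∃ a : ℝ, 0 < a ∧ ∀ x : En n, -Φ (x, 1) ≤ C * Real.exp (-a * ‖x‖ ^ 2))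

/-- The set `S` of locally uniform sequential limits of the rescalings
`u^σ(x,t) = σ^α u(σ^{1/2} x, σ t)` as `σ → ∞`. -/
def limitSet (n : ℕ) (α : ℝ) (u : En n × ℝ → ℝ) : Set (En n × ℝ → ℝ) :=
  { U | ContinuousOn U (Qset n) ∧ ∃ σ : ℕ → ℝ,
      Tendsto σ atTop atTop ∧
      TendstoLocallyUniformlyOn
        (fun k (p : En n × ℝ) => (σ k) ^ α * u (Real.sqrt (σ k) • p.1, σ k * p.2))
        U atTop (Qset n) }

section SupConvolution

open scoped RealInnerProductSpace

variable {E : Type*} [NormedAddCommGroup E] [InnerProductSpace ℝ E]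

/-- `A x` is a maximum point of `y ↦ u y - κ/2 * ‖x - y‖²`, for every `x`. -/
def IsSupConvSelection (u : E → ℝ) (κ : ℝ) (A : E → E) : Prop :=
  ∀ x y, u y - κ / 2 * ‖x - y‖ ^ 2 ≤ u (A x) - κ / 2 * ‖x - A x‖ ^ 2

/-- The sup-convolution of `u`, computed from a selection of maximum points. -/
def supConv (u : E → ℝ) (κ : ℝ) (A : E → E) (x : E) : ℝ :=
  u (A x) - κ / 2 * ‖x - A x‖ ^ 2

lemma exists_isSupConvSelection [FiniteDimensional ℝ E] {u : E → ℝ} (hu : Continuous u) {C : ℝ}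
    (hC : ∀ y, u y ≤ C) {κ : ℝ} (hκ : 0 < κ) : ∃ A : E → E, IsSupConvSelection u κ A := by
  have key : ∀ x : E, ∃ z, ∀ y, u y - κ / 2 * ‖x - y‖ ^ 2 ≤ u z - κ / 2 * ‖x - z‖ ^ 2 := by
    intro x
    have hlim : Tendsto (fun y : E => u y - κ / 2 * ‖x - y‖ ^ 2) (cocompact E) atBot := by
      have h1 : Tendsto (fun y : E => ‖x - y‖) (cocompact E) atTop := by
        exact (tendsto_dist_left_cocompact_atTop x).congr fun y => dist_eq_norm x y
      have h2 : Tendsto (fun y : E => κ / 2 * ‖x - y‖ ^ 2) (cocompact E) atTop :=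
        ((tendsto_pow_atTop two_ne_zero).comp h1).const_mul_atTop (by positivity)
      have h3 : Tendsto (fun y : E => C - κ / 2 * ‖x - y‖ ^ 2) (cocompact E) atBot := by
        simpa [sub_eq_add_neg] using
          tendsto_atBot_add_const_left _ C (tendsto_neg_atTop_atBot.comp h2)
      exact tendsto_atBot_mono (fun y => by linarith [hC y]) h3
    exact Continuous.exists_forall_ge (by fun_prop) hlim
  choose A hA using key
  exact ⟨A, hA⟩

namespace IsSupConvSelection

variable {u : E → ℝ} {κ : ℝ} {A : E → E}

lemma le_supConv (hA : IsSupConvSelection u κ A) (x : E) : u x ≤ supConv u κ A x := by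
  have := hA x x
  simpa [supConv] using this

lemma supConv_lower (hA : IsSupConvSelection u κ A) (x x' : E) :
    supConv u κ A x + ⟪κ • (A x - x), x' - x⟫ - κ / 2 * ‖x' - x‖ ^ 2 ≤ supConv u κ A x' := by
  have h := hA x' (A x)
  have e : ‖x' - A x‖ ^ 2 = ‖x' - x‖ ^ 2 - 2 * ⟪A x - x, x' - x⟫ + ‖x - A x‖ ^ 2 := by
    rw [show x' - A x = (x' - x) - (A x - x) by abel, norm_sub_sq_real, real_inner_comm,
      norm_sub_rev x]
  rw [e] at h
  simp only [supConv, inner_smul_left] at *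
  simp only [conj_trivial]
  linarith

lemma monotone (hA : IsSupConvSelection u κ A) (hκ : 0 < κ) (x x' : E) :
    0 ≤ ⟪x - x', A x - A x'⟫ := by
  have h1 := hA.supConv_lower x x'
  have h2 := hA.supConv_lower x' x
  rw [norm_sub_rev x' x] at h1
  have : κ * ⟪x - x', A x - A x'⟫ = κ * ‖x - x'‖ ^ 2
      - ⟪κ • (A x - x), x' - x⟫ - ⟪κ • (A x' - x'), x - x'⟫ := by
    rw [← real_inner_self_eq_norm_sq]
    simp only [inner_smul_left, inner_sub_left, inner_sub_right, conj_trivial]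
    rw [real_inner_comm x (A x), real_inner_comm x (A x'), real_inner_comm x' (A x),
      real_inner_comm x' (A x')]
    ring
  by_contra hcon
  push Not at hcon
  have := mul_neg_of_pos_of_neg hκ hcon
  linarith

lemma norm_sub_le (hA : IsSupConvSelection u κ A) (hκ : 0 < κ) (x x' : E) :
    ‖x - x'‖ ≤ ‖(x + A x) - (x' + A x')‖ := by
  have h := hA.monotone hκ x x'
  have e : (x + A x) - (x' + A x') = (x - x') + (A x - A x') := by abel
  have : ‖x - x'‖ ^ 2 ≤ ‖(x + A x) - (x' + A x')‖ ^ 2 := by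
    rw [e, norm_add_sq_real]
    nlinarith [sq_nonneg ‖A x - A x'‖]
  exact le_of_sq_le_sq this (norm_nonneg _)

lemma continuousOn_supConv (hA : IsSupConvSelection u κ A) (hκ : 0 < κ) {s : Set E}
    (hs : ∀ x ∈ s, ‖A x - x‖ ≤ 1) : ContinuousOn (supConv u κ A) s := by
  have key : ∀ x ∈ s, ∀ x', supConv u κ A x - supConv u κ A x' ≤
      κ * ‖x' - x‖ + κ / 2 * ‖x' - x‖ ^ 2 := by
    intro x hx x'
    have h1 := hA.supConv_lower x x'
    have h2 : |⟪κ • (A x - x), x' - x⟫| ≤ κ * ‖x' - x‖ := by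
      refine (abs_real_inner_le_norm _ _).trans ?_
      rw [norm_smul, Real.norm_of_nonneg hκ.le]
      gcongr
      nlinarith [hs x hx]
    linarith [neg_abs_le ⟪κ • (A x - x), x' - x⟫]
  intro x hx
  rw [ContinuousWithinAt, tendsto_iff_dist_tendsto_zero]
  have hlim : Tendsto (fun x' => κ * ‖x' - x‖ + κ / 2 * ‖x' - x‖ ^ 2) (𝓝[s] x) (𝓝 0) := by
    have : Continuous (fun x' => κ * ‖x' - x‖ + κ / 2 * ‖x' - x‖ ^ 2) := by fun_prop
    have := this.tendsto x
    simp only [sub_self, norm_zero, mul_zero, ne_eq, OfNat.ofNat_ne_zero, not_false_eq_true,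
      zero_pow, add_zero] at this
    exact this.mono_left nhdsWithin_le_nhds
  refine tendsto_of_tendsto_of_tendsto_of_le_of_le' tendsto_const_nhds hlim
    (Eventually.of_forall fun _ => dist_nonneg) ?_
  filter_upwards [self_mem_nhdsWithin] with x' hx'
  rw [Real.dist_eq, abs_sub_le_iff]
  refine ⟨?_, key x hx x'⟩
  have := key x' hx' x
  rwa [norm_sub_rev x x'] at this

end IsSupConvSelection

/-- For large `κ` the maximum points defining the sup-convolution are close to the base point,
locally uniformly. -/
lemma exists_supConv_close [FiniteDimensional ℝ E] {u : E → ℝ} (hu : Continuous u) {C : ℝ}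
    (hC : ∀ y, u y ≤ C) (x₀ : E) (R : ℝ) {θ : ℝ} (hθ : 0 < θ) :
    ∃ κ₀ : ℝ, 0 < κ₀ ∧ ∀ κ, κ₀ ≤ κ → ∀ A : E → E, IsSupConvSelection u κ A →
      ∀ x ∈ Metric.closedBall x₀ R, ‖A x - x‖ ≤ θ ∧ κ * ‖A x - x‖ ^ 2 ≤ θ ∧
        supConv u κ A x ≤ u x + θ := by
  have hK : IsCompact (Metric.closedBall x₀ (R + 1)) := isCompact_closedBall _ _
  obtain ⟨N, hN⟩ := hK.exists_bound_of_continuousOn hu.continuousOn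
  have huc := hK.uniformContinuousOn_of_continuous hu.continuousOn
  rw [Metric.uniformContinuousOn_iff] at huc
  obtain ⟨δ, hδ, huc⟩ := huc (θ / 2) (by positivity)
  set τ := min (min (δ / 2) θ) 1 with hτ
  have hτ0 : 0 < τ := by positivity
  have hCN : 0 ≤ |C| + |N| := by positivity
  refine ⟨2 * (|C| + |N| + 1) / τ ^ 2, by positivity, fun κ hκ A hA x hx => ?_⟩
  have hκ0 : 0 < κ := lt_of_lt_of_le (by positivity) hκ
  have hx1 : x ∈ Metric.closedBall x₀ (R + 1) :=
    Metric.closedBall_subset_closedBall (by linarith) hx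
  have h1 : κ / 2 * ‖A x - x‖ ^ 2 ≤ u (A x) - u x := by
    have := hA x x
    simp only [sub_self, norm_zero, ne_eq, OfNat.ofNat_ne_zero, not_false_eq_true, zero_pow,
      mul_zero, sub_zero] at this
    rw [norm_sub_rev]
    linarith
  have h2 : u (A x) - u x ≤ |C| + |N| := by
    have := hN x hx1
    rw [Real.norm_eq_abs] at this
    linarith [hC (A x), neg_abs_le (u x), le_abs_self C, le_abs_self N]
  have h3 : ‖A x - x‖ ≤ τ := by
    rw [div_le_iff₀ (by positivity)] at hκ
    by_contra hcon
    push Not at hcon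
    have : τ ^ 2 < ‖A x - x‖ ^ 2 := by gcongr
    nlinarith
  have hτθ : τ ≤ θ := (min_le_left _ _).trans (min_le_right _ _)
  have hτδ : τ ≤ δ / 2 := (min_le_left _ _).trans (min_le_left _ _)
  have hτ1 : τ ≤ 1 := min_le_right _ _
  have hAx : A x ∈ Metric.closedBall x₀ (R + 1) := by
    rw [Metric.mem_closedBall] at hx ⊢
    have := dist_triangle (A x) x x₀
    rw [dist_eq_norm (A x) x] at this
    linarith
  have h4 : u (A x) - u x ≤ θ / 2 := by
    have := huc (A x) hAx x hx1 (by rw [dist_eq_norm]; linarith)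
    rw [Real.dist_eq] at this
    linarith [le_abs_self (u (A x) - u x)]
  refine ⟨h3.trans hτθ, by linarith, ?_⟩
  have : 0 ≤ κ / 2 * ‖x - A x‖ ^ 2 := by positivity
  simp only [supConv]
  linarith

/-- If a function is touched from above at `x` by a paraboloid, the slopes of paraboloids touching
it from below depend on the base point in a Lipschitz way at `x`. -/
lemma norm_slope_sub_le {G : E → ℝ} {m : ℝ} {x x' s s' : E}
    (hup : ∀ y, ‖y - x‖ ≤ 2 * ‖x' - x‖ → G y ≤ G x + ⟪s, y - x⟫ + m * ‖y - x‖ ^ 2)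
    (hlow : G x + ⟪s, x' - x⟫ - m * ‖x' - x‖ ^ 2 ≤ G x')
    (hlow' : ∀ y, ‖y - x‖ ≤ 2 * ‖x' - x‖ → G x' + ⟪s', y - x'⟫ - m * ‖y - x'‖ ^ 2 ≤ G y)
    (hm : 0 ≤ m) (hne : x' ≠ x) : ‖s' - s‖ ≤ 6 * m * ‖x' - x‖ := by
  set d := ‖x' - x‖ with hd
  have hd0 : 0 < d := norm_pos_iff.2 (sub_ne_zero.2 hne)
  rcases eq_or_ne s' s with h | h
  · rw [h, sub_self, norm_zero]; positivity
  have hs : 0 < ‖s' - s‖ := norm_pos_iff.2 (sub_ne_zero.2 h)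
  set y := x' + (d / ‖s' - s‖) • (s' - s) with hy
  have hyx' : y - x' = (d / ‖s' - s‖) • (s' - s) := by simp [hy]
  have n1 : ‖y - x'‖ = d := by
    rw [hyx', norm_smul, Real.norm_of_nonneg (by positivity)]
    field_simp
  have n2 : ‖y - x‖ ≤ 2 * d := by
    have : y - x = (y - x') + (x' - x) := by abel
    rw [this]
    refine (norm_add_le _ _).trans ?_
    rw [n1, ← hd]; linarith
  have h1 := hup y n2
  have h2 := hlow' y n2
  have e1 : ⟪s' - s, y - x'⟫ = d * ‖s' - s‖ := by
    rw [hyx', inner_smul_right, real_inner_self_eq_norm_sq]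
    field_simp
  have e2 : ⟪s' - s, y - x'⟫ = ⟪s', y - x'⟫ + ⟪s, x' - x⟫ - ⟪s, y - x⟫ := by
    simp only [inner_sub_left, inner_sub_right]; ring
  have h3 : ‖y - x‖ ^ 2 ≤ (2 * d) ^ 2 := by gcongr
  rw [n1] at h2
  have : d * ‖s' - s‖ ≤ d * (6 * m * d) := by nlinarith
  exact le_of_mul_le_mul_left this hd0

/-- Touching paraboloids from above and from below have the same slope. -/
lemma slope_unique {G : E → ℝ} {m : ℝ} {x p s : E}
    (hup : ∀ᶠ y in 𝓝 x, G y ≤ G x + ⟪p, y - x⟫ + m * ‖y - x‖ ^ 2)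
    (hlow : ∀ᶠ y in 𝓝 x, G x + ⟪s, y - x⟫ - m * ‖y - x‖ ^ 2 ≤ G y) : s = p := by
  have hc : Tendsto (fun t : ℝ => x + t • (s - p)) (𝓝[>] 0) (𝓝 x) := by
    have : Continuous (fun t : ℝ => x + t • (s - p)) := by fun_prop
    have := this.tendsto 0
    simp only [zero_smul, add_zero] at this
    exact this.mono_left nhdsWithin_le_nhds
  have h1 : ∀ᶠ t : ℝ in 𝓝[>] 0, ‖s - p‖ ^ 2 ≤ 2 * m * t * ‖s - p‖ ^ 2 := by
    filter_upwards [hc.eventually hup, hc.eventually hlow, self_mem_nhdsWithin] with t h1 h2 ht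
    have ht : 0 < t := ht
    simp only [add_sub_cancel_left, inner_smul_right, norm_smul, Real.norm_of_nonneg ht.le] at h1 h2
    have e : ⟪s, s - p⟫ - ⟪p, s - p⟫ = ‖s - p‖ ^ 2 := by
      rw [← inner_sub_left, real_inner_self_eq_norm_sq]
    have : t * ‖s - p‖ ^ 2 ≤ t * (2 * m * t * ‖s - p‖ ^ 2) := by
      rw [← e, mul_sub, e]; nlinarith
    exact le_of_mul_le_mul_left this ht
  have h2 : Tendsto (fun t : ℝ => 2 * m * t * ‖s - p‖ ^ 2) (𝓝[>] 0) (𝓝 0) := by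
    have : Continuous (fun t : ℝ => 2 * m * t * ‖s - p‖ ^ 2) := by fun_prop
    have := this.tendsto 0
    simp only [mul_zero, zero_mul] at this
    exact this.mono_left nhdsWithin_le_nhds
  have h3 := ge_of_tendsto h2 h1
  have h4 : ‖s - p‖ = 0 := by nlinarith [norm_nonneg (s - p)]
  exact sub_eq_zero.1 (norm_eq_zero.1 h4)

/-- A map with a left inverse that is differentiable along its range is differentiable at every
point where it is Lipschitz. -/
lemma exists_hasFDerivAt_of_leftInverse [FiniteDimensional ℝ E] {Z J : E → E}
    (hJZ : Function.LeftInverse J Z) {x : E} {K : ℝ}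
    (hZ : ∀ᶠ x' in 𝓝 x, ‖Z x' - Z x‖ ≤ K * ‖x' - x‖)
    (hJ : DifferentiableWithinAt ℝ J (range Z) (Z x)) : ∃ D : E →L[ℝ] E, HasFDerivAt Z D x := by
  obtain ⟨L, hL⟩ := hJ
  have hcont : ContinuousAt Z x := by
    rw [ContinuousAt, tendsto_iff_norm_sub_tendsto_zero]
    refine tendsto_of_tendsto_of_tendsto_of_le_of_le' tendsto_const_nhds ?_
      (Eventually.of_forall fun _ => norm_nonneg _) hZ
    have : Continuous fun x' : E => K * ‖x' - x‖ := by fun_prop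
    simpa using this.tendsto x
  have htend : Tendsto Z (𝓝 x) (𝓝[range Z] (Z x)) :=
    tendsto_nhdsWithin_iff.2 ⟨hcont, Eventually.of_forall fun y => mem_range_self y⟩
  have hO : (fun x' => Z x' - Z x) =O[𝓝 x] fun x' => x' - x :=
    Asymptotics.IsBigO.of_bound K hZ
  have ho : (fun x' => x' - x - L (Z x' - Z x)) =o[𝓝 x] fun x' => x' - x := by
    have := (hL.isLittleO.comp_tendsto htend).trans_isBigO hO
    refine this.congr_left fun y => ?_
    simp [hJZ y, hJZ x]
  have hsurj : Function.Surjective L := by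
    have : (LinearMap.range (L : E →ₗ[ℝ] E)) = ⊤ := by
      rw [← Submodule.orthogonal_eq_bot_iff, Submodule.eq_bot_iff]
      intro w hw
      have h0 : HasFDerivAt (fun x' => ⟪w, x'⟫) (0 : E →L[ℝ] ℝ) x := by
        refine HasFDerivAt.of_isLittleO ?_
        have h1 : (fun x' => ⟪w, x' - x - L (Z x' - Z x)⟫) =o[𝓝 x] fun x' => x' - x :=
          (Asymptotics.IsBigO.of_bound ‖w‖ (Eventually.of_forall fun y =>
            norm_inner_le_norm _ _)).trans_isLittleO ho
        refine h1.congr_left fun y => ?_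
        have : ⟪w, L (Z y - Z x)⟫ = 0 :=
          (Submodule.mem_orthogonal' _ _).1 hw _ (LinearMap.mem_range_self (L : E →ₗ[ℝ] E) _)
        rw [inner_sub_right, this, inner_sub_right]
        simp
      have h1 : HasFDerivAt (fun x' => ⟪w, x'⟫) (innerSL ℝ w) x := (innerSL ℝ w).hasFDerivAt
      have h2 := congrArg (fun T : E →L[ℝ] ℝ => T w) (h0.unique h1)
      simpa using h2.symm
    exact LinearMap.range_eq_top.1 this
  have hinj : Function.Injective L :=
    (LinearMap.injective_iff_surjective (f := (L : E →ₗ[ℝ] E))).2 hsurj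
  let e : E ≃L[ℝ] E := (LinearEquiv.ofBijective (L : E →ₗ[ℝ] E) ⟨hinj, hsurj⟩).toContinuousLinearEquiv
  have he : (e : E →L[ℝ] E) = L := by ext; rfl
  refine ⟨(e.symm : E →L[ℝ] E), ?_⟩
  rw [← hasFDerivWithinAt_univ]
  refine HasFDerivWithinAt.of_local_left_inverse (t := range Z) (f := J) ?_ (he ▸ hL) (mem_univ _)
    (Eventually.of_forall hJZ)
  rwa [nhdsWithin_univ]

lemma sub_le_of_slope_le {h w : ℝ → ℝ} {c d η : ℝ}
    (hh : ∀ s t, 0 ≤ s → t ≤ 1 → s ≤ t → h t - h s ≤ w t * (t - s))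
    (hw : ∀ s, 0 ≤ s → s ≤ 1 → w s ≤ c + d * s + η) : h 1 - h 0 ≤ c + d / 2 + η := by
  have key : ∀ N : ℕ, h 1 - h 0 ≤ c + d / 2 + η + d / 2 * (1 / ((N : ℝ) + 1)) := by
    intro N
    have hN : (0 : ℝ) < N + 1 := by positivity
    have step : ∀ M : ℕ, M ≤ N + 1 → h (M / (N + 1)) - h 0 ≤
        M * ((c + η) / (N + 1)) + d / (N + 1) ^ 2 * (M * (M + 1) / 2) := by
      intro M
      induction M with
      | zero => intro _; simp
      | succ M ih =>
        intro hM
        have hM' : ((M : ℝ) + 1) ≤ N + 1 := by exact_mod_cast hM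
        have h1 := ih (by omega)
        have hle : ((M : ℝ) + 1) / (N + 1) ≤ 1 := by rwa [div_le_one hN]
        have h2 := hh (M / (N + 1)) ((M + 1) / (N + 1)) (by positivity) hle (by gcongr; linarith)
        have h3 := hw ((M + 1) / (N + 1)) (by positivity) hle
        have e : ((M : ℝ) + 1) / (N + 1) - M / (N + 1) = 1 / (N + 1) := by ring
        rw [e] at h2
        have h4 : w (((M : ℝ) + 1) / (N + 1)) * (1 / (N + 1)) ≤
            (c + d * ((M + 1) / (N + 1)) + η) * (1 / (N + 1)) := by gcongr
        push_cast
        have e2 : ((M : ℝ) + 1) * ((c + η) / (N + 1)) + d / (N + 1) ^ 2 * ((M + 1) * (M + 1 + 1) / 2)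
            = M * ((c + η) / (N + 1)) + d / (N + 1) ^ 2 * (M * (M + 1) / 2)
              + (c + d * ((M + 1) / (N + 1)) + η) * (1 / (N + 1)) := by
          field_simp; ring
        rw [e2]; linarith
    have := step (N + 1) le_rfl
    push_cast at this
    rw [div_self hN.ne'] at this
    refine this.trans_eq ?_
    field_simp; ring
  have hlim : Tendsto (fun N : ℕ => c + d / 2 + η + d / 2 * (1 / ((N : ℝ) + 1))) atTop
      (𝓝 (c + d / 2 + η + d / 2 * 0)) :=
    (tendsto_one_div_add_atTop_nhds_zero_nat.const_mul _).const_add _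
  have := ge_of_tendsto' hlim key
  linarith

/-- A function on `[0, 1]` with subgradient `w` close to an affine function is close to the
corresponding quadratic function. -/
lemma abs_sub_le_of_slope {h w : ℝ → ℝ} {c d η : ℝ}
    (hh : ∀ s t, h t - h s ≤ w t * (t - s))
    (hw : ∀ s, 0 ≤ s → s ≤ 1 → |w s - c - d * s| ≤ η) : |h 1 - h 0 - c - d / 2| ≤ η := by
  have h1 : h 1 - h 0 ≤ c + d / 2 + η :=
    sub_le_of_slope_le (fun s t _ _ _ => hh s t) fun s h0 h1 => by
      have := (abs_le.1 (hw s h0 h1)).2; linarith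
  have h2 := sub_le_of_slope_le (h := fun s => h (1 - s)) (w := fun s => - w (1 - s))
    (c := -(c + d)) (d := d) (η := η)
    (fun s t _ _ _ => by have := hh (1 - s) (1 - t); linarith)
    (fun s h0 h1 => by
      have := (abs_le.1 (hw (1 - s) (by linarith) (by linarith))).1; linarith)
  simp only [sub_self, sub_zero] at h2
  rw [abs_le]
  constructor <;> linarith

/-- Second order expansion of the sup-convolution at a point of differentiability of the
selection. -/
lemma IsSupConvSelection.expansion {u : E → ℝ} {κ : ℝ} {A : E → E}
    (hA : IsSupConvSelection u κ A) (hκ : 0 < κ) {x : E} {D : E →L[ℝ] E} (hD : HasFDerivAt A D x)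
    {ε : ℝ} (hε : 0 < ε) : ∀ᶠ y in 𝓝 x,
      |supConv u κ A y - supConv u κ A x - ⟪κ • (A x - x), y - x⟫
        - 1 / 2 * ⟪κ • (D (y - x) - (y - x)), y - x⟫| ≤ ε * ‖y - x‖ ^ 2 := by
  have h1 := hD.isLittleO.def (c := ε / κ) (by positivity)
  obtain ⟨r, hr, h1⟩ := Metric.eventually_nhds_iff_ball.1 h1
  filter_upwards [Metric.ball_mem_nhds x hr] with y hy
  set e := y - x with he
  have hyx : y = x + (1 : ℝ) • e := by simp [he]
  have hen : ‖e‖ < r := by rwa [mem_ball_iff_norm] at hy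
  have key := abs_sub_le_of_slope
    (h := fun s => supConv u κ A (x + s • e) + κ / 2 * ‖x + s • e‖ ^ 2)
    (w := fun s => κ * ⟪A (x + s • e), e⟫) (c := κ * ⟪A x, e⟫) (d := κ * ⟪D e, e⟫)
    (η := ε * ‖e‖ ^ 2) ?_ ?_
  · have e1 : ‖x + (1 : ℝ) • e‖ ^ 2 = ‖x‖ ^ 2 + 2 * ⟪x, e⟫ + ‖e‖ ^ 2 := by
      rw [one_smul, norm_add_sq_real]
    rw [← hyx] at e1
    simp only [zero_smul, add_zero, ← hyx, e1] at key
    simp only [inner_smul_left, inner_sub_left, conj_trivial, real_inner_self_eq_norm_sq]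
    convert key using 2
    ring
  · intro s t
    have := hA.supConv_lower (x + t • e) (x + s • e)
    have e1 : x + s • e - (x + t • e) = (s - t) • e := by rw [sub_smul]; abel
    rw [e1] at this
    simp only [inner_smul_left, inner_smul_right, inner_sub_left, inner_add_left,
      norm_smul, mul_pow, Real.norm_eq_abs, sq_abs, conj_trivial, real_inner_self_eq_norm_sq] at this
    simp only [norm_add_sq_real, norm_smul, mul_pow, Real.norm_eq_abs, sq_abs, inner_smul_right]
    nlinarith
  · intro s h0 hs1
    have hmem : x + s • e ∈ Metric.ball x r := by
      rw [mem_ball_iff_norm, add_sub_cancel_left, norm_smul, Real.norm_of_nonneg h0]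
      nlinarith [norm_nonneg e]
    have h2 := h1 _ hmem
    rw [add_sub_cancel_left] at h2
    have e1 : κ * ⟪A (x + s • e), e⟫ - κ * ⟪A x, e⟫ - κ * ⟪D e, e⟫ * s
        = κ * ⟪A (x + s • e) - A x - D (s • e), e⟫ := by
      simp only [map_smul, inner_sub_left, inner_smul_left, conj_trivial]; ring
    rw [e1, abs_mul, abs_of_pos hκ]
    calc κ * |⟪A (x + s • e) - A x - D (s • e), e⟫|
        ≤ κ * (ε / κ * ‖s • e‖ * ‖e‖) := by
          gcongr
          exact (abs_real_inner_le_norm _ _).trans (by gcongr)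
      _ = ε * s * ‖e‖ ^ 2 := by
          rw [norm_smul, Real.norm_of_nonneg h0]; field_simp
      _ ≤ ε * ‖e‖ ^ 2 := by
          have : ε * s ≤ ε := by nlinarith
          gcongr

/-- The quadratic polynomial with gradient `b` at `x₀` and Hessian `S`, vanishing at `x₀`. -/
def quadPoly (x₀ b : E) (S : E →L[ℝ] E) (y : E) : ℝ :=
  ⟪b, y - x₀⟫ + 1 / 2 * ⟪S (y - x₀), y - x₀⟫

lemma continuous_quadPoly (x₀ b : E) (S : E →L[ℝ] E) : Continuous (quadPoly x₀ b S) := by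
  unfold quadPoly; fun_prop

lemma quadPoly_recenter {S : E →L[ℝ] E} (hS : ∀ x y, ⟪S x, y⟫ = ⟪x, S y⟫) (x₀ b x y : E) :
    quadPoly x₀ b S y = quadPoly x₀ b S x + quadPoly x (b + S (x - x₀)) S y := by
  have e : y - x₀ = (y - x) + (x - x₀) := by abel
  have h : ⟪S (y - x), x - x₀⟫ = ⟪S (x - x₀), y - x⟫ := by
    rw [hS, real_inner_comm]
  simp only [quadPoly, e, map_add, inner_add_left, inner_add_right, h]
  ring

lemma abs_half_inner_le (S : E →L[ℝ] E) (e : E) :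
    |1 / 2 * ⟪S e, e⟫| ≤ ‖S‖ / 2 * ‖e‖ ^ 2 := by
  rw [abs_mul, abs_of_pos (by norm_num : (0 : ℝ) < 1 / 2)]
  have : |⟪S e, e⟫| ≤ ‖S‖ * ‖e‖ * ‖e‖ :=
    (abs_real_inner_le_norm _ _).trans (by gcongr; exact S.le_opNorm e)
  nlinarith

/-- Perturbing by a small linear function, one finds a maximum point of a sum of two
sup-convolutions and a quadratic polynomial at which the first selection is differentiable. -/
lemma exists_contact_differentiable [FiniteDimensional ℝ E] {u W : E → ℝ} {κ : ℝ} (hκ : 0 < κ)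
    {A B : E → E} (hA : IsSupConvSelection u κ A) (hB : IsSupConvSelection W κ B)
    {S : E →L[ℝ] E} (hS : ∀ x y, ⟪S x, y⟫ = ⟪x, S y⟫) {x₀ b : E} {r δ : ℝ} (hr : 0 < r)
    (hδ : 0 < δ) (ψ : E → ℝ)
    (hψ : ∀ x, ψ x = supConv u κ A x + supConv W κ B x - quadPoly x₀ b S x)
    (hcont : ContinuousOn ψ (Metric.closedBall x₀ r))
    (hstrict : ∀ x ∈ Metric.closedBall x₀ r, r / 8 ≤ ‖x - x₀‖ → ψ x + 2 * δ * r ≤ ψ x₀) :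
    ∃ x p : E, ‖x - x₀‖ < r / 8 ∧ ‖p‖ < δ ∧
      (∀ y ∈ Metric.closedBall x₀ r, ψ y ≤ ψ x + ⟪p, y - x⟫) ∧
      ∃ D : E →L[ℝ] E, HasFDerivAt A D x := by
  have hmax : ∀ p : E, ∃ x, p ∈ Metric.ball (0 : E) δ → ‖x - x₀‖ < r / 8 ∧
      ∀ y ∈ Metric.closedBall x₀ r, ψ y ≤ ψ x + ⟪p, y - x⟫ := by
    intro p
    by_cases hp : p ∈ Metric.ball (0 : E) δ
    swap
    · exact ⟨x₀, fun h => absurd h hp⟩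
    have hpδ : ‖p‖ < δ := by simpa using hp
    obtain ⟨x, hx, hxmax⟩ := (isCompact_closedBall x₀ r).exists_isMaxOn
      ⟨x₀, Metric.mem_closedBall_self hr.le⟩
      (f := fun y => ψ y - ⟪p, y - x₀⟫) (hcont.sub (by fun_prop))
    refine ⟨x, fun _ => ⟨?_, fun y hy => ?_⟩⟩
    · by_contra hcon
      push Not at hcon
      have h1 := hstrict x hx hcon
      have h2 : ψ x₀ - ⟪p, x₀ - x₀⟫ ≤ ψ x - ⟪p, x - x₀⟫ := hxmax (Metric.mem_closedBall_self hr.le)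
      rw [sub_self, inner_zero_right, sub_zero] at h2
      have h3 : |⟪p, x - x₀⟫| ≤ δ * r := by
        refine (abs_real_inner_le_norm _ _).trans ?_
        rw [mem_closedBall_iff_norm] at hx
        gcongr
      have h4 := neg_abs_le ⟪p, x - x₀⟫
      have h5 : 0 < δ * r := by positivity
      linarith
    · have h2 : ψ y - ⟪p, y - x₀⟫ ≤ ψ x - ⟪p, x - x₀⟫ := hxmax hy
      have : ⟪p, y - x⟫ = ⟪p, y - x₀⟫ - ⟪p, x - x₀⟫ := by
        rw [← inner_sub_right]; congr 1; abel
      linarith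
  choose X hX using hmax
  set m := κ + ‖S‖ with hm
  have hm0 : 0 ≤ m := by positivity
  set s : E → E := fun x => κ • (A x - x) + κ • (B x - x) - (b + S (x - x₀)) with hs
  have hlow : ∀ x y, ψ x + ⟪s x, y - x⟫ - m * ‖y - x‖ ^ 2 ≤ ψ y := by
    intro x y
    have h1 := hA.supConv_lower x y
    have h2 := hB.supConv_lower x y
    have h3 := quadPoly_recenter hS x₀ b x y
    have h4 := (abs_le.1 (abs_half_inner_le S (y - x))).2
    have h5 : 0 ≤ ‖S‖ * ‖y - x‖ ^ 2 := by positivity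
    have h8 : quadPoly x (b + S (x - x₀)) S y
        = ⟪b + S (x - x₀), y - x⟫ + 1 / 2 * ⟪S (y - x), y - x⟫ := rfl
    rw [hψ, hψ, h3, hs, hm, h8]
    simp only [inner_sub_left, inner_add_left] at *
    linarith
  have hnhds : ∀ p ∈ Metric.ball (0 : E) δ, Metric.closedBall x₀ r ∈ 𝓝 (X p) := by
    intro p hp
    refine Filter.mem_of_superset (Metric.isOpen_ball.mem_nhds ?_) Metric.ball_subset_closedBall
    rw [mem_ball_iff_norm]
    linarith [(hX p hp).1]
  have hsX : ∀ p ∈ Metric.ball (0 : E) δ, s (X p) = p := by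
    intro p hp
    refine slope_unique (G := ψ) (m := m) ?_ (Eventually.of_forall fun y => hlow (X p) y)
    filter_upwards [hnhds p hp] with y hy
    have := (hX p hp).2 y hy
    have : 0 ≤ m * ‖y - X p‖ ^ 2 := by positivity
    linarith
  have hball : ∀ p ∈ Metric.ball (0 : E) δ, ∀ p' ∈ Metric.ball (0 : E) δ, ∀ y,
      ‖y - X p‖ ≤ 2 * ‖X p' - X p‖ → y ∈ Metric.closedBall x₀ r := by
    intro p hp p' hp' y hy
    have h1 := (hX p hp).1
    have h2 := (hX p' hp').1
    have h3 : ‖X p' - X p‖ ≤ ‖X p' - x₀‖ + ‖X p - x₀‖ := by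
      rw [show X p' - X p = (X p' - x₀) - (X p - x₀) by abel]; exact norm_sub_le _ _
    have h4 : ‖y - x₀‖ ≤ ‖y - X p‖ + ‖X p - x₀‖ := by
      rw [show y - x₀ = (y - X p) + (X p - x₀) by abel]; exact norm_add_le _ _
    rw [mem_closedBall_iff_norm]
    linarith
  have hLip : ∀ p ∈ Metric.ball (0 : E) δ, ∀ p' ∈ Metric.ball (0 : E) δ,
      ‖p' - p‖ ≤ 6 * m * ‖X p' - X p‖ := by
    intro p hp p' hp'
    rcases eq_or_ne (X p') (X p) with h | h
    · rw [← hsX p hp, ← hsX p' hp', h, sub_self, norm_zero, sub_self, norm_zero, mul_zero]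
    refine norm_slope_sub_le (G := ψ) (fun y hy => ?_) ?_ (fun y _ => ?_) hm0 h
    · have := (hX p hp).2 y (hball p hp p' hp' y hy)
      have : 0 ≤ m * ‖y - X p‖ ^ 2 := by positivity
      linarith
    · have := hlow (X p) (X p')
      rwa [hsX p hp] at this
    · have := hlow (X p') y
      rwa [hsX p' hp'] at this
  set Z : E → E := fun x => x + A x with hZ
  have hZinj : Function.Injective Z := fun x x' h => by
    have := hA.norm_sub_le hκ x x'
    rw [show x + A x = x' + A x' from h, sub_self, norm_zero] at this
    exact sub_eq_zero.1 (norm_le_zero_iff.1 this)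
  set J := Function.invFun Z with hJ
  have hJZ : Function.LeftInverse J Z := Function.leftInverse_invFun hZinj
  have hJlip : LipschitzOnWith 1 J (range Z) := by
    refine LipschitzOnWith.of_dist_le_mul ?_
    rintro _ ⟨x, rfl⟩ _ ⟨x', rfl⟩
    rw [hJZ x, hJZ x', dist_eq_norm, dist_eq_norm, NNReal.coe_one, one_mul]
    exact hA.norm_sub_le hκ x x'
  let _ : MeasurableSpace E := borel E
  have : BorelSpace E := ⟨rfl⟩
  have hrad := hJlip.ae_differentiableWithinAt_of_mem
    (μ := MeasureTheory.Measure.hausdorffMeasure (X := E) (Module.finrank ℝ E))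
  obtain ⟨p, hp, hdiff⟩ : ∃ p ∈ Metric.ball (0 : E) δ,
      DifferentiableWithinAt ℝ J (range Z) (Z (X p)) := by
    by_contra! hcon
    set N := (fun p => Z (X p)) '' Metric.ball (0 : E) δ with hN
    have hN0 : MeasureTheory.Measure.hausdorffMeasure (X := E) (Module.finrank ℝ E) N = 0 := by
      refine MeasureTheory.measure_mono_null ?_ (MeasureTheory.ae_iff.1 hrad)
      rintro _ ⟨p, hp, rfl⟩
      simpa using hcon p hp
    have hlipN : LipschitzOnWith (Real.toNNReal (6 * m)) (fun z => s (J z)) N := by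
      refine LipschitzOnWith.of_dist_le_mul ?_
      rintro _ ⟨p, hp, rfl⟩ _ ⟨p', hp', rfl⟩
      simp only [hJZ (X p), hJZ (X p'), hsX p hp, hsX p' hp', dist_eq_norm]
      rw [Real.coe_toNNReal _ (by positivity)]
      exact (hLip p' hp' p hp).trans (by gcongr; exact hA.norm_sub_le hκ _ _)
    have himg : (fun z => s (J z)) '' N = Metric.ball (0 : E) δ := by
      rw [hN, image_image]
      ext p
      constructor
      · rintro ⟨p', hp', rfl⟩
        simpa only [hJZ (X p'), hsX p' hp'] using hp'
      · intro hp
        exact ⟨p, hp, by simp only [hJZ (X p), hsX p hp]⟩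
    have := hlipN.hausdorffMeasure_image_le (d := Module.finrank ℝ E) (Nat.cast_nonneg _)
    rw [himg, hN0, mul_zero] at this
    exact (Metric.measure_ball_pos
      (MeasureTheory.Measure.hausdorffMeasure (X := E) (Module.finrank ℝ E)) 0 hδ).not_ge this
  refine ⟨X p, p, (hX p hp).1, by simpa using hp, (hX p hp).2, ?_⟩
  set x := X p with hx
  have hup : ∀ y ∈ Metric.closedBall x₀ r,
      supConv u κ A y ≤ supConv u κ A x + ⟪κ • (A x - x), y - x⟫ + m * ‖y - x‖ ^ 2 := by
    intro y hy
    have h1 := (hX p hp).2 y hy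
    have h2 := hB.supConv_lower x y
    have h3 := quadPoly_recenter hS x₀ b x y
    have h4 := (abs_le.1 (abs_half_inner_le S (y - x))).2
    have h5 : 0 ≤ ‖S‖ * ‖y - x‖ ^ 2 := by positivity
    have h6 : 0 ≤ κ * ‖y - x‖ ^ 2 := by positivity
    have h7 : ⟪p, y - x⟫ = ⟪s x, y - x⟫ := by rw [hsX p hp]
    have h8 : quadPoly x (b + S (x - x₀)) S y
        = ⟪b + S (x - x₀), y - x⟫ + 1 / 2 * ⟪S (y - x), y - x⟫ := rfl
    rw [← hx, hψ, hψ, h3, h7, hs, h8] at h1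
    rw [hm]
    simp only [inner_sub_left, inner_add_left] at *
    linarith
  have hAlip : ∀ᶠ x' in 𝓝 x, ‖Z x' - Z x‖ ≤ (1 + (6 * m / κ + 1)) * ‖x' - x‖ := by
    have hxr := (hX p hp).1
    filter_upwards [Metric.ball_mem_nhds x (show 0 < r / 4 by positivity)] with x' hx'
    rw [mem_ball_iff_norm] at hx'
    rcases eq_or_ne x' x with h | h
    · simp [h]
    have h1 : ‖κ • (A x' - x') - κ • (A x - x)‖ ≤ 6 * m * ‖x' - x‖ := by
      refine norm_slope_sub_le (G := supConv u κ A) (fun y hy => hup y ?_) ?_ (fun y _ => ?_) hm0 h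
      · have h4 : ‖y - x₀‖ ≤ ‖y - x‖ + ‖x - x₀‖ := by
          rw [show y - x₀ = (y - x) + (x - x₀) by abel]; exact norm_add_le _ _
        rw [mem_closedBall_iff_norm]
        linarith
      · have := hA.supConv_lower x x'
        have h5 : 0 ≤ ‖S‖ * ‖x' - x‖ ^ 2 := by positivity
        have h6 : 0 ≤ κ * ‖x' - x‖ ^ 2 := by positivity
        rw [hm]; linarith
      · have := hA.supConv_lower x' y
        have h5 : 0 ≤ ‖S‖ * ‖y - x'‖ ^ 2 := by positivity
        have h6 : 0 ≤ κ * ‖y - x'‖ ^ 2 := by positivity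
        rw [hm]; linarith
    have h2 : ‖(A x' - x') - (A x - x)‖ ≤ 6 * m / κ * ‖x' - x‖ := by
      rw [← smul_sub, norm_smul, Real.norm_of_nonneg hκ.le] at h1
      rw [div_mul_eq_mul_div, le_div_iff₀ hκ]
      linarith
    have h3 : Z x' - Z x = ((A x' - x') - (A x - x)) + (2 : ℝ) • (x' - x) := by
      simp only [hZ, two_smul]; abel
    rw [h3]
    refine (norm_add_le _ _).trans ?_
    rw [norm_smul, Real.norm_of_nonneg (by norm_num : (0 : ℝ) ≤ 2)]
    linarith
  obtain ⟨D, hD⟩ := exists_hasFDerivAt_of_leftInverse hJZ hAlip hdiff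
  refine ⟨D - ContinuousLinearMap.id ℝ E, ?_⟩
  have := hD.sub (hasFDerivAt_id x)
  refine this.congr_of_eventuallyEq (Eventually.of_forall fun y => ?_)
  simp [hZ]

/-- The theorem on sums in second-order jet form: if `u + W` is strictly touched from above by a
quadratic polynomial with Hessian `S`, then at nearby points `u` and `W` have second-order
superjets whose Hessians add up to `S`, up to an arbitrarily small error. -/
theorem exists_jets_of_touching [FiniteDimensional ℝ E] {u W : E → ℝ} (hu : Continuous u)
    (hW : Continuous W) {Cu CW : ℝ} (hCu : ∀ y, u y ≤ Cu) (hCW : ∀ y, W y ≤ CW)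
    {S : E →L[ℝ] E} (hS : ∀ x y, ⟪S x, y⟫ = ⟪x, S y⟫) {x₀ b : E} {η : ℝ} (hη : 0 < η)
    (htouch : ∀ᶠ y in 𝓝 x₀,
      u y + W y ≤ u x₀ + W x₀ + quadPoly x₀ b S y - η * ‖y - x₀‖ ^ 2)
    {θ : ℝ} (hθ : 0 < θ) :
    ∃ (x x₁ x₂ p q : E) (T : E →L[ℝ] E), (∀ x y, ⟪T x, y⟫ = ⟪x, T y⟫) ∧
      ‖x - x₀‖ ≤ θ ∧ ‖x₁ - x₀‖ ≤ θ ∧ ‖x₂ - x₀‖ ≤ θ ∧ ‖p‖ ≤ θ ∧ |⟪q, x₁ - x₂⟫| ≤ θ ∧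
      (∀ᶠ y in 𝓝 x₁, u y ≤ u x₁ + quadPoly x₁ q T y + θ * ‖y - x₁‖ ^ 2) ∧
      (∀ᶠ y in 𝓝 x₂,
        W y ≤ W x₂ + quadPoly x₂ (b + S (x - x₀) + p - q) (S - T) y + θ * ‖y - x₂‖ ^ 2) := by
  have : CompleteSpace E := FiniteDimensional.complete ℝ E
  obtain ⟨r₁, hr₁, htouch⟩ := Metric.eventually_nhds_iff_ball.1 htouch
  set r := min (r₁ / 2) θ with hr
  have hr0 : 0 < r := by positivity
  have hrr : r < r₁ := (min_le_left _ _).trans_lt (by linarith)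
  have hrθ : r ≤ θ := min_le_right _ _
  set τ := min (min (θ / 2) 1) (η * r ^ 2 / 256) with hτ
  have hτ0 : 0 < τ := by positivity
  have hτθ : τ ≤ θ / 2 := (min_le_left _ _).trans (min_le_left _ _)
  have hτ1 : τ ≤ 1 := (min_le_left _ _).trans (min_le_right _ _)
  have hτη : τ ≤ η * r ^ 2 / 256 := min_le_right _ _
  set δ := min θ (η * r / 256) with hδ
  have hδ0 : 0 < δ := by positivity
  have hδθ : δ ≤ θ := min_le_left _ _
  have hδη : δ ≤ η * r / 256 := min_le_right _ _
  obtain ⟨κ₁, hκ₁, hclose₁⟩ := exists_supConv_close hu hCu x₀ r hτ0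
  obtain ⟨κ₂, hκ₂, hclose₂⟩ := exists_supConv_close hW hCW x₀ r hτ0
  set κ := max κ₁ κ₂ with hκ
  have hκ0 : 0 < κ := lt_max_of_lt_left hκ₁
  obtain ⟨A, hA⟩ := exists_isSupConvSelection hu hCu hκ0
  obtain ⟨B, hB⟩ := exists_isSupConvSelection hW hCW hκ0
  replace hclose₁ := hclose₁ κ (le_max_left _ _) A hA
  replace hclose₂ := hclose₂ κ (le_max_right _ _) B hB
  set ψ : E → ℝ := fun x => supConv u κ A x + supConv W κ B x - quadPoly x₀ b S x with hψ
  have hcont : ContinuousOn ψ (Metric.closedBall x₀ r) :=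
    ((hA.continuousOn_supConv hκ0 fun x hx => (hclose₁ x hx).1.trans hτ1).add
      (hB.continuousOn_supConv hκ0 fun x hx => (hclose₂ x hx).1.trans hτ1)).sub
      (continuous_quadPoly x₀ b S).continuousOn
  have hstrict : ∀ x ∈ Metric.closedBall x₀ r, r / 8 ≤ ‖x - x₀‖ → ψ x + 2 * δ * r ≤ ψ x₀ := by
    intro x hx hxr
    have h1 := (hclose₁ x hx).2.2
    have h2 := (hclose₂ x hx).2.2
    have h3 := htouch x (Metric.closedBall_subset_ball hrr hx)
    have h4 := hA.le_supConv x₀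
    have h5 := hB.le_supConv x₀
    have h6 : quadPoly x₀ b S x₀ = 0 := by simp [quadPoly]
    have h7 : (r / 8) ^ 2 ≤ ‖x - x₀‖ ^ 2 := by gcongr
    have h8 : η * (r / 8) ^ 2 ≤ η * ‖x - x₀‖ ^ 2 := by gcongr
    have h9 : δ * r ≤ η * r / 256 * r := by gcongr
    simp only [hψ, h6]
    nlinarith
  obtain ⟨x, p, hx, hp, hmax, D, hD⟩ := exists_contact_differentiable hκ0 hA hB hS hr0 hδ0 ψ
    (fun _ => rfl) hcont hstrict
  have hxr : x ∈ Metric.closedBall x₀ r := by rw [mem_closedBall_iff_norm]; linarith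
  obtain ⟨hA1, hA2, -⟩ := hclose₁ x hxr
  obtain ⟨hB1, hB2, -⟩ := hclose₂ x hxr
  set T : E →L[ℝ] E := κ • ((1 / 2 : ℝ) • (D + ContinuousLinearMap.adjoint D)
    - ContinuousLinearMap.id ℝ E) with hT
  have hTq : ∀ e, ⟪T e, e⟫ = ⟪κ • (D e - e), e⟫ := by
    intro e
    simp only [hT, _root_.smul_apply, _root_.sub_apply,
      _root_.add_apply, ContinuousLinearMap.id_apply, inner_smul_left,
      inner_sub_left, inner_add_left, conj_trivial, ContinuousLinearMap.adjoint_inner_left]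
    rw [real_inner_comm e (D e)]
    ring
  have hnear : ∀ y : E, Tendsto (fun z => x + (z - y)) (𝓝 y) (𝓝 x) := by
    intro y
    have : Continuous fun z => x + (z - y) := by fun_prop
    simpa using this.tendsto y
  have hexp := hA.expansion hκ0 hD hθ
  refine ⟨x, A x, B x, p, κ • (A x - x), T, ?_, by linarith, ?_, ?_, by linarith, ?_, ?_, ?_⟩
  · intro y z
    simp only [hT, _root_.smul_apply, _root_.sub_apply,
      _root_.add_apply, ContinuousLinearMap.id_apply, inner_smul_left,
      inner_sub_left, inner_add_left, conj_trivial, ContinuousLinearMap.adjoint_inner_left,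
      inner_smul_right, inner_sub_right, inner_add_right, ContinuousLinearMap.adjoint_inner_right]
    ring
  · calc ‖A x - x₀‖ = ‖(A x - x) + (x - x₀)‖ := by congr 1; abel
      _ ≤ ‖A x - x‖ + ‖x - x₀‖ := norm_add_le _ _
      _ ≤ θ := by linarith
  · calc ‖B x - x₀‖ = ‖(B x - x) + (x - x₀)‖ := by congr 1; abel
      _ ≤ ‖B x - x‖ + ‖x - x₀‖ := norm_add_le _ _
      _ ≤ θ := by linarith
  · have h1 : A x - B x = (A x - x) - (B x - x) := by abel
    have h2 := abs_real_inner_le_norm (A x - x) (B x - x)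
    have h3 : κ * (‖A x - x‖ * ‖B x - x‖) ≤ κ * ((‖A x - x‖ ^ 2 + ‖B x - x‖ ^ 2) / 2) := by
      gcongr
      nlinarith [sq_nonneg (‖A x - x‖ - ‖B x - x‖)]
    have h4 : κ * |⟪A x - x, B x - x⟫| ≤ κ * (‖A x - x‖ * ‖B x - x‖) := by gcongr
    rw [h1, inner_smul_left, inner_sub_right, real_inner_self_eq_norm_sq, conj_trivial,
      abs_mul, abs_of_pos hκ0]
    have h5 := abs_sub (‖A x - x‖ ^ 2) ⟪A x - x, B x - x⟫
    rw [abs_of_nonneg (sq_nonneg ‖A x - x‖)] at h5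
    have h6 := mul_le_mul_of_nonneg_left h5 hκ0.le
    linarith
  · filter_upwards [(hnear (A x)).eventually hexp] with y hy
    have h1 := hA (x + (y - A x)) y
    rw [show x + (y - A x) - y = x - A x by abel] at h1
    have h2 : supConv u κ A x = u (A x) - κ / 2 * ‖x - A x‖ ^ 2 := rfl
    have h3 : supConv u κ A (x + (y - A x)) = u (A (x + (y - A x))) -
      κ / 2 * ‖x + (y - A x) - A (x + (y - A x))‖ ^ 2 := rfl
    rw [add_sub_cancel_left] at hy
    have h4 := (abs_le.1 hy).2
    rw [← hTq] at h4
    rw [quadPoly]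
    linarith
  · have hball : ∀ᶠ y in 𝓝 x, y ∈ Metric.closedBall x₀ r := by
      refine Filter.mem_of_superset (Metric.isOpen_ball.mem_nhds (x := x) (s := Metric.ball x₀ r) ?_)
        Metric.ball_subset_closedBall
      rw [mem_ball_iff_norm]
      linarith
    filter_upwards [(hnear (B x)).eventually hexp, (hnear (B x)).eventually hball] with y hy hyr
    have h1 := hB (x + (y - B x)) y
    rw [show x + (y - B x) - y = x - B x by abel] at h1
    have h2 : supConv W κ B x = W (B x) - κ / 2 * ‖x - B x‖ ^ 2 := rfl
    have h3 : supConv W κ B (x + (y - B x)) = W (B (x + (y - B x))) -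
      κ / 2 * ‖x + (y - B x) - B (x + (y - B x))‖ ^ 2 := rfl
    have h5 := hmax _ hyr
    have h6 := quadPoly_recenter hS x₀ b x (x + (y - B x))
    have h7 : quadPoly x (b + S (x - x₀)) S (x + (y - B x))
      = ⟪b + S (x - x₀), y - B x⟫ + 1 / 2 * ⟪S (y - B x), y - B x⟫ := by
      rw [quadPoly, add_sub_cancel_left]
    rw [add_sub_cancel_left] at hy h5
    have h4 := (abs_le.1 hy).1
    rw [← hTq] at h4
    simp only [hψ] at h5
    rw [quadPoly, _root_.sub_apply]
    simp only [inner_sub_left, inner_add_left] at *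
    linarith

end SupConvolution

section Pucci

variable {n : ℕ} {lam Lam : ℝ}

lemma smul_one_mem_pucciMatrices (hLam : lam ≤ Lam) :
    lam • (1 : Mat n) ∈ PucciMatrices n lam Lam := by
  have hA : (lam • (1 : Mat n)).IsHermitian := by
    simp [Matrix.IsHermitian]
  refine ⟨hA, fun i => ?_⟩
  have h1 : hA.eigenvalues i = lam := by
    have h2 : ‖hA.eigenvectorBasis i‖ ^ 2 = 1 := by rw [OrthonormalBasis.norm_eq_one, one_pow]
    rw [EuclideanSpace.real_norm_sq_eq] at h2
    rw [hA.eigenvalues_eq]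
    rw [Matrix.smul_mulVec, Matrix.one_mulVec, dotProduct_smul, star_trivial, smul_eq_mul,
      RCLike.re_to_real, dotProduct]
    simp only [← pow_two, h2, mul_one]
  rw [h1]
  exact ⟨le_rfl, hLam⟩

lemma dotProduct_mulVec_bounds {A : Mat n} (hA : A ∈ PucciMatrices n lam Lam) (d : Fin n → ℝ) :
    lam * (d ⬝ᵥ d) ≤ d ⬝ᵥ A *ᵥ d ∧ d ⬝ᵥ A *ᵥ d ≤ Lam * (d ⬝ᵥ d) := by
  obtain ⟨hA, hev⟩ := hA
  have hspec : ∀ x ∈ spectrum ℝ A, x ∈ Icc lam Lam := by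
    rw [hA.spectrum_real_eq_range_eigenvalues]
    rintro _ ⟨i, rfl⟩
    exact hev i
  have hscal : ∀ c : ℝ, (c • (1 : Mat n)).IsHermitian := fun c => by
    simp [Matrix.IsHermitian]
  constructor
  · have h1 : (A - lam • (1 : Mat n)).IsHermitian := hA.sub (hscal lam)
    have h2 : (A - lam • (1 : Mat n)).PosSemidef := by
      rw [h1.posSemidef_iff_eigenvalues_nonneg]
      intro i
      have h3 : h1.eigenvalues i ∈ spectrum ℝ (A - lam • (1 : Mat n)) := by
        rw [h1.spectrum_real_eq_range_eigenvalues]; exact mem_range_self i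
      change 0 ≤ h1.eigenvalues i
      generalize h1.eigenvalues i = e at h3 ⊢
      rw [← Algebra.algebraMap_eq_smul_one, ← spectrum.sub_singleton_eq] at h3
      obtain ⟨x, hx, y, hy, h⟩ := h3
      rw [mem_singleton_iff] at hy
      have := (hspec x hx).1
      simp only at h
      rw [← h, hy]
      simpa using this
    have h4 := h2.dotProduct_mulVec_nonneg d
    rw [Matrix.sub_mulVec, dotProduct_sub, Matrix.smul_mulVec, Matrix.one_mulVec, dotProduct_smul,
      star_trivial, smul_eq_mul] at h4
    linarith
  · have h1 : (Lam • (1 : Mat n) - A).IsHermitian := (hscal Lam).sub hA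
    have h2 : (Lam • (1 : Mat n) - A).PosSemidef := by
      rw [h1.posSemidef_iff_eigenvalues_nonneg]
      intro i
      have h3 : h1.eigenvalues i ∈ spectrum ℝ (Lam • (1 : Mat n) - A) := by
        rw [h1.spectrum_real_eq_range_eigenvalues]; exact mem_range_self i
      change 0 ≤ h1.eigenvalues i
      generalize h1.eigenvalues i = e at h3 ⊢
      rw [← Algebra.algebraMap_eq_smul_one, ← spectrum.singleton_sub_eq] at h3
      obtain ⟨y, hy, x, hx, h⟩ := h3
      rw [mem_singleton_iff] at hy
      have := (hspec x hx).2
      simp only at h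
      rw [← h, hy]
      simpa using this
    have h4 := h2.dotProduct_mulVec_nonneg d
    rw [Matrix.sub_mulVec, dotProduct_sub, Matrix.smul_mulVec, Matrix.one_mulVec, dotProduct_smul,
      star_trivial, smul_eq_mul] at h4
    linarith

lemma trace_bounds {A : Mat n} (hA : A ∈ PucciMatrices n lam Lam) :
    n * lam ≤ A.trace ∧ A.trace ≤ n * Lam := by
  obtain ⟨hA, hev⟩ := hA
  rw [hA.trace_eq_sum_eigenvalues]
  constructor
  · have := Finset.card_nsmul_le_sum Finset.univ hA.eigenvalues lam fun i _ => (hev i).1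
    simpa using this
  · have := Finset.sum_le_card_nsmul Finset.univ hA.eigenvalues Lam fun i _ => (hev i).2
    simpa using this

lemma le_pucciMinus (hLam : lam ≤ Lam) {M : Mat n} {μ : ℝ}
    (h : ∀ A ∈ PucciMatrices n lam Lam, μ ≤ -(A * M).trace) : μ ≤ PucciMinus n lam Lam M := by
  refine le_csInf ⟨_, mem_image_of_mem _ (smul_one_mem_pucciMatrices hLam)⟩ ?_
  rintro _ ⟨A, hA, rfl⟩
  exact h A hA

end Pucci

section Jets

open scoped RealInnerProductSpace

variable {n : ℕ}

/-- The matrix of the bilinear form `(x, y) ↦ ⟪T x, y⟫`. -/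
def hessMat (T : En n →L[ℝ] En n) : Mat n :=
  Matrix.of fun i j => ⟪T (EuclideanSpace.single i 1), EuclideanSpace.single j 1⟫

/-- The operator `x ↦ c x + k ⟪d, x⟫ d`. -/
def radialOp (c k : ℝ) (d : En n) : En n →L[ℝ] En n :=
  c • ContinuousLinearMap.id ℝ (En n) + k • (innerSL ℝ d).smulRight d

lemma radialOp_apply (c k : ℝ) (d x : En n) : radialOp c k d x = c • x + k • ⟪d, x⟫ • d := by
  simp [radialOp]

lemma radialOp_symm (c k : ℝ) (d x y : En n) : ⟪radialOp c k d x, y⟫ = ⟪x, radialOp c k d y⟫ := by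
  simp only [radialOp_apply, inner_add_left, inner_add_right, inner_smul_left, inner_smul_right,
    conj_trivial, real_inner_comm x d]
  ring

lemma hessMat_isSymm {T : En n →L[ℝ] En n} (hT : ∀ x y, ⟪T x, y⟫ = ⟪x, T y⟫) :
    (hessMat T).IsSymm := by
  ext i j
  simp only [hessMat, Matrix.transpose_apply, Matrix.of_apply]
  rw [hT, real_inner_comm]

lemma hessMat_sub (S T : En n →L[ℝ] En n) : hessMat (S - T) = hessMat S - hessMat T := by
  ext i j
  simp [hessMat, inner_sub_left]

lemma hessMat_smul (c : ℝ) (T : En n →L[ℝ] En n) : hessMat (c • T) = c • hessMat T := by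
  ext i j
  simp [hessMat, inner_smul_left]

lemma hessMat_add (S T : En n →L[ℝ] En n) : hessMat (S + T) = hessMat S + hessMat T := by
  ext i j
  simp [hessMat, inner_add_left]

lemma trace_mul_hessMat_radialOp (A : Mat n) (c k : ℝ) (d : En n) :
    (A * hessMat (radialOp c k d)).trace = c * A.trace + k * (d.ofLp ⬝ᵥ A *ᵥ d.ofLp) := by
  have h : hessMat (radialOp c k d) = c • (1 : Mat n) + k • Matrix.vecMulVec d.ofLp d.ofLp := by
    ext i j
    simp only [hessMat, radialOp_apply, Matrix.of_apply, inner_add_left, inner_smul_left,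
      EuclideanSpace.inner_single_right, conj_trivial, Matrix.add_apply, Matrix.smul_apply,
      Matrix.vecMulVec_apply, smul_eq_mul, Matrix.one_apply, PiLp.single_apply]
    simp [eq_comm]
  rw [h, mul_add, Matrix.mul_smul, Matrix.mul_smul, mul_one, Matrix.mul_vecMulVec,
    Matrix.trace_add, Matrix.trace_smul, Matrix.trace_smul, Matrix.trace_vecMulVec,
    smul_eq_mul, smul_eq_mul, dotProduct_comm d.ofLp]

lemma contDiff_quadPoly (x q : En n) (T : En n →L[ℝ] En n) : ContDiff ℝ 2 (quadPoly x q T) := by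
  unfold quadPoly
  have h : ContDiff ℝ 2 fun y : En n => y - x := contDiff_id.sub contDiff_const
  exact (contDiff_const.inner ℝ h).add (contDiff_const.mul ((T.contDiff.comp h).inner ℝ h))

lemma fderiv_quadPoly {T : En n →L[ℝ] En n} (hT : ∀ x y, ⟪T x, y⟫ = ⟪x, T y⟫) (x q z : En n) :
    fderiv ℝ (quadPoly x q T) z = innerSL ℝ (q + T (z - x)) := by
  have h : HasFDerivAt (fun y : En n => y - x) (ContinuousLinearMap.id ℝ (En n)) z :=
    (hasFDerivAt_id z).sub_const x
  have h1 := ((hasFDerivAt_const q z).inner ℝ h).add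
    (((T.hasFDerivAt.comp z h).inner ℝ h).const_mul (1 / 2))
  have h2 : fderiv ℝ (quadPoly x q T) z = _ := h1.fderiv
  rw [h2]
  ext e
  have h3 : ⟪T e, z - x⟫ = ⟪T (z - x), e⟫ := by rw [hT, real_inner_comm]
  simp [fderivInnerCLM_apply, -map_sub, h3]
  ring

lemma hess_quadPoly {T : En n →L[ℝ] En n} (hT : ∀ x y, ⟪T x, y⟫ = ⟪x, T y⟫) (x q : En n) :
    hess n (quadPoly x q T) x = hessMat T := by
  ext i j
  have h : ∀ z, fderiv ℝ (quadPoly x q T) z (EuclideanSpace.single j 1)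
      = ⟪q, EuclideanSpace.single j 1⟫
        + ((innerSL ℝ (EuclideanSpace.single j 1 : En n)).comp T) (z - x) := by
    intro z
    rw [fderiv_quadPoly hT]
    simp [-map_sub, real_inner_comm]
  simp only [hess, hessMat, Matrix.of_apply, h]
  have h2 : HasFDerivAt (fun z : En n => ⟪q, EuclideanSpace.single j 1⟫
      + ((innerSL ℝ (EuclideanSpace.single j 1 : En n)).comp T) (z - x))
      ((innerSL ℝ (EuclideanSpace.single j 1 : En n)).comp T) x := by
    have := ((innerSL ℝ (EuclideanSpace.single j 1 : En n)).comp T).hasFDerivAt.comp x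
      ((hasFDerivAt_id x).sub_const x)
    exact this.const_add _
  rw [h2.fderiv]
  simp [real_inner_comm]

variable {F : Mat n → ℝ} {α : ℝ} {f u v : En n → ℝ}

lemma ViscSubE.le_of_jet (hsub : ViscSubE n Set.univ (Fop n F α f) u) {T : En n →L[ℝ] En n}
    (hT : ∀ x y, ⟪T x, y⟫ = ⟪x, T y⟫) {y q : En n}
    (h : ∀ᶠ z in 𝓝 y, u z ≤ u y + quadPoly y q T z) :
    F (hessMat T) - 1 / 2 * ⟪q, y⟫ - α * u y ≤ f y := by
  have h1 := hsub y (mem_univ y) (quadPoly y q T) (contDiff_quadPoly y q T) (by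
    rw [isLocalMaxOn_univ_iff]
    filter_upwards [h] with z hz
    have : quadPoly y q T y = 0 := by simp [quadPoly]
    rw [this]; linarith)
  rw [hess_quadPoly hT, fderiv_quadPoly hT] at h1
  simp only [Fop, sub_self, map_zero, add_zero, innerSL_apply_apply] at h1
  linarith

lemma ViscSupE.le_of_jet (hsup : ViscSupE n Set.univ (Fop n F α f) v) {T : En n →L[ℝ] En n}
    (hT : ∀ x y, ⟪T x, y⟫ = ⟪x, T y⟫) {y q : En n}
    (h : ∀ᶠ z in 𝓝 y, v y + quadPoly y q T z ≤ v z) :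
    f y ≤ F (hessMat T) - 1 / 2 * ⟪q, y⟫ - α * v y := by
  have h1 := hsup y (mem_univ y) (quadPoly y q T) (contDiff_quadPoly y q T) (by
    rw [isLocalMinOn_univ_iff]
    filter_upwards [h] with z hz
    have : quadPoly y q T y = 0 := by simp [quadPoly]
    rw [this]; linarith)
  rw [hess_quadPoly hT, fderiv_quadPoly hT] at h1
  simp only [Fop, sub_self, map_zero, add_zero, innerSL_apply_apply] at h1
  linarith

lemma ViscSupE.le_of_jet_mul (hsup : ViscSupE n Set.univ (Fop n F α f) v)
    (hFh : PositivelyHomogeneous n F) (hf0 : ∀ y, 0 ≤ f y) {t : ℝ} (ht : 1 ≤ t)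
    {T : En n →L[ℝ] En n} (hT : ∀ x y, ⟪T x, y⟫ = ⟪x, T y⟫) {y q : En n}
    (h : ∀ᶠ z in 𝓝 y, t * v y + quadPoly y q T z ≤ t * v z) :
    f y ≤ F (hessMat T) - 1 / 2 * ⟪q, y⟫ - α * (t * v y) := by
  have ht0 : 0 < t := by linarith
  have h1 := hsup.le_of_jet (T := t⁻¹ • T) (y := y) (q := t⁻¹ • q)
    (fun x z => by simp [inner_smul_left, inner_smul_right, hT]) (by
      filter_upwards [h] with z hz
      have : quadPoly y (t⁻¹ • q) (t⁻¹ • T) z = t⁻¹ * quadPoly y q T z := by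
        simp only [quadPoly, _root_.smul_apply, inner_smul_left, conj_trivial]; ring
      rw [this]
      have h2 := mul_le_mul_of_nonneg_left hz (inv_nonneg.2 ht0.le)
      rw [mul_add, inv_mul_cancel_left₀ ht0.ne', inv_mul_cancel_left₀ ht0.ne'] at h2
      exact h2)
  rw [hessMat_smul, hFh _ _ (inv_nonneg.2 ht0.le), inner_smul_left, conj_trivial] at h1
  have h2 := mul_le_mul_of_nonneg_left h1 ht0.le
  have h3 : t * (t⁻¹ * F (hessMat T) - 1 / 2 * (t⁻¹ * ⟪q, y⟫) - α * v y)
      = F (hessMat T) - 1 / 2 * ⟪q, y⟫ - α * (t * v y) := by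
    field_simp
  rw [h3] at h2
  nlinarith [hf0 y]

end Jets

section Comparison

open scoped RealInnerProductSpace

variable {n : ℕ} {lam Lam : ℝ} {F : Mat n → ℝ} {α : ℝ} {f u V : En n → ℝ}

/-- `w` is a viscosity subsolution of `P⁻(D²w) - y·Dw/2 - αw = 0`, tested against quadratic
polynomials touching strictly from above. -/
def IsPucciSub (n : ℕ) (lam Lam α : ℝ) (w : En n → ℝ) : Prop :=
  ∀ (x₀ b : En n) (S : En n →L[ℝ] En n), (∀ x y, ⟪S x, y⟫ = ⟪x, S y⟫) → ∀ η : ℝ, 0 < η →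
    (∀ᶠ y in 𝓝 x₀, w y ≤ w x₀ + quadPoly x₀ b S y - η * ‖y - x₀‖ ^ 2) →
    ∀ μ : ℝ, (∀ A ∈ PucciMatrices n lam Lam, μ ≤ -(A * hessMat S).trace) →
      μ - 1 / 2 * ⟪b, x₀⟫ - α * w x₀ ≤ 0

/-- A difference of a subsolution and a supersolution (both described by their second-order jets)
is a subsolution of the Pucci minimal equation. -/
theorem isPucciSub_sub (hLam : lam ≤ Lam) (hF : UniformlyElliptic n lam Lam F)
    (hu : Continuous u) (hV : Continuous V) (hf : Continuous f) {Cu : ℝ} (hCu : ∀ y, u y ≤ Cu)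
    (hV0 : ∀ y, 0 ≤ V y)
    (hsub : ∀ (y q : En n) (T : En n →L[ℝ] En n), (∀ x z, ⟪T x, z⟫ = ⟪x, T z⟫) →
      (∀ᶠ z in 𝓝 y, u z ≤ u y + quadPoly y q T z) →
      F (hessMat T) - 1 / 2 * ⟪q, y⟫ - α * u y ≤ f y)
    (hsup : ∀ (y q : En n) (T : En n →L[ℝ] En n), (∀ x z, ⟪T x, z⟫ = ⟪x, T z⟫) →
      (∀ᶠ z in 𝓝 y, V y + quadPoly y q T z ≤ V z) →
      f y ≤ F (hessMat T) - 1 / 2 * ⟪q, y⟫ - α * V y) :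
    IsPucciSub n lam Lam α fun y => u y - V y := by
  intro x₀ b S hS η hη htouch μ hμ
  have hradial : ∀ (c : ℝ) (x q y : En n) (T : En n →L[ℝ] En n),
      quadPoly x q (T + radialOp (2 * c) 0 0) y = quadPoly x q T y + c * ‖y - x‖ ^ 2 := by
    intro c x q y T
    simp only [quadPoly, _root_.add_apply, inner_add_left, radialOp_apply, zero_smul, add_zero,
      inner_smul_left, conj_trivial, real_inner_self_eq_norm_sq]
    ring
  have hsymm : ∀ (c : ℝ) (T : En n →L[ℝ] En n), (∀ x z, ⟪T x, z⟫ = ⟪x, T z⟫) →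
      ∀ x z, ⟪(T + radialOp (2 * c) 0 0 : En n →L[ℝ] En n) x, z⟫
        = ⟪x, (T + radialOp (2 * c) 0 0 : En n →L[ℝ] En n) z⟫ := by
    intro c T hT x z
    simp only [_root_.add_apply, inner_add_left, inner_add_right, hT x z, radialOp_symm]
  have key : ∀ k : ℕ, ∃ x x₁ x₂ p : En n,
      ‖x - x₀‖ ≤ 1 / ((k : ℝ) + 1) ∧ ‖x₁ - x₀‖ ≤ 1 / ((k : ℝ) + 1) ∧
      ‖x₂ - x₀‖ ≤ 1 / ((k : ℝ) + 1) ∧ ‖p‖ ≤ 1 / ((k : ℝ) + 1) ∧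
      μ - 4 * (1 / ((k : ℝ) + 1)) * (n * Lam) - 1 / 2 * (1 / ((k : ℝ) + 1))
        - 1 / 2 * ⟪b + S (x - x₀) + p, x₂⟫ - α * (u x₁ - V x₂) - f x₁ + f x₂ ≤ 0 := by
    intro k
    set θ : ℝ := 1 / ((k : ℝ) + 1) with hθ
    have hθ0 : 0 < θ := by positivity
    obtain ⟨x, x₁, x₂, p, q, T, hT, hx, hx₁, hx₂, hp, hq, h1, h2⟩ :=
      exists_jets_of_touching (W := fun y => - V y) hu hV.neg hCu (CW := 0)
        (fun y => neg_nonpos.2 (hV0 y)) hS hη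
        (htouch.mono fun y hy => by linarith) hθ0
    refine ⟨x, x₁, x₂, p, hx, hx₁, hx₂, hp, ?_⟩
    have hTS : ∀ x z, ⟪(T - S) x, z⟫ = ⟪x, (T - S) z⟫ := fun x z => by
      simp only [_root_.sub_apply, inner_sub_left, inner_sub_right, hT x z, hS x z]
    have e1 := hsub x₁ q (T + radialOp (2 * θ) 0 0) (hsymm θ T hT)
      (h1.mono fun y hy => by rw [hradial]; linarith)
    have e2 := hsup x₂ (q - (b + S (x - x₀) + p)) (T - S + radialOp (2 * (-θ)) 0 0)
      (hsymm (-θ) _ hTS) (h2.mono fun y hy => by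
        rw [hradial]
        simp only [quadPoly, _root_.sub_apply, inner_sub_left, inner_add_left] at hy ⊢
        linarith)
    have e3 := (hF _ _ (hessMat_isSymm (hsymm θ T hT)) (hessMat_isSymm (hsymm (-θ) _ hTS))).1
    have e4 : hessMat (T + radialOp (2 * θ) 0 0) - hessMat (T - S + radialOp (2 * (-θ)) 0 0)
        = hessMat S + hessMat (radialOp (4 * θ) 0 0) := by
      rw [← hessMat_sub, ← hessMat_add]
      congr 1
      ext1 y
      simp only [_root_.sub_apply, _root_.add_apply, radialOp_apply]
      module
    have e5 : μ - 4 * θ * (n * Lam) ≤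
        PucciMinus n lam Lam (hessMat S + hessMat (radialOp (4 * θ) 0 0)) := by
      refine le_pucciMinus hLam fun A hA => ?_
      rw [mul_add, Matrix.trace_add, trace_mul_hessMat_radialOp, zero_mul, add_zero]
      have := hμ A hA
      have := mul_le_mul_of_nonneg_left (trace_bounds hA).2 (by positivity : 0 ≤ 4 * θ)
      linarith
    rw [e4] at e3
    have e6 := (abs_le.1 hq).2
    rw [inner_sub_right] at e6
    rw [inner_sub_left] at e2
    linarith
  choose x x₁ x₂ p hx hx₁ hx₂ hp hE using key
  have hθ : Tendsto (fun k : ℕ => 1 / ((k : ℝ) + 1)) atTop (𝓝 0) :=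
    tendsto_one_div_add_atTop_nhds_zero_nat
  have hlim : ∀ z : ℕ → En n, (∀ k, ‖z k - x₀‖ ≤ 1 / ((k : ℝ) + 1)) →
      Tendsto z atTop (𝓝 x₀) := fun z hz =>
    tendsto_iff_norm_sub_tendsto_zero.2 (squeeze_zero (fun _ => norm_nonneg _) hz hθ)
  have hxl := hlim x hx
  have hx₁l := hlim x₁ hx₁
  have hx₂l := hlim x₂ hx₂
  have hpl : Tendsto p atTop (𝓝 0) := squeeze_zero_norm hp hθ
  have hSl : Tendsto (fun k => S (x k - x₀)) atTop (𝓝 0) := by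
    have : Continuous fun z => S (z - x₀) := by fun_prop
    simpa [Function.comp_def] using (this.tendsto x₀).comp hxl
  have hbl : Tendsto (fun k => b + S (x k - x₀) + p k) atTop (𝓝 b) := by
    simpa using (hSl.const_add b).add hpl
  have hlimE : Tendsto (fun k : ℕ =>
      μ - 4 * (1 / ((k : ℝ) + 1)) * (n * Lam) - 1 / 2 * (1 / ((k : ℝ) + 1))
        - 1 / 2 * ⟪b + S (x k - x₀) + p k, x₂ k⟫ - α * (u (x₁ k) - V (x₂ k))
        - f (x₁ k) + f (x₂ k)) atTop
      (𝓝 (μ - 4 * 0 * (n * Lam) - 1 / 2 * 0 - 1 / 2 * ⟪b, x₀⟫ - α * (u x₀ - V x₀)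
        - f x₀ + f x₀)) :=
    ((((((hθ.const_mul 4).mul_const _).const_sub μ).sub (hθ.const_mul _)).sub
      ((hbl.inner hx₂l).const_mul _)).sub
      ((((hu.tendsto x₀).comp hx₁l).sub ((hV.tendsto x₀).comp hx₂l)).const_mul α)).sub
      ((hf.tendsto x₀).comp hx₁l) |>.add ((hf.tendsto x₀).comp hx₂l)
  have := le_of_tendsto hlimE (Eventually.of_forall hE)
  linarith

lemma eventually_abs_taylor_two_le {ρ ρ' : ℝ → ℝ} {ρ₂ s₀ : ℝ}
    (hρ : ∀ᶠ s in 𝓝 s₀, HasDerivAt ρ (ρ' s) s) (hρ' : HasDerivAt ρ' ρ₂ s₀) {ε : ℝ} (hε : 0 < ε) :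
    ∀ᶠ s in 𝓝 s₀, |ρ s - ρ s₀ - ρ' s₀ * (s - s₀) - ρ₂ / 2 * (s - s₀) ^ 2| ≤ ε * (s - s₀) ^ 2 := by
  have h1 := hρ'.isLittleO.def hε
  obtain ⟨r, hr, h⟩ := Metric.eventually_nhds_iff_ball.1 (hρ.and h1)
  filter_upwards [Metric.ball_mem_nhds s₀ hr] with s hs
  set g : ℝ → ℝ := fun t => ρ t - ρ' s₀ * (t - s₀) - ρ₂ / 2 * (t - s₀) ^ 2 with hg
  have hsub : Metric.closedBall s₀ |s - s₀| ⊆ Metric.ball s₀ r :=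
    Metric.closedBall_subset_ball (by rwa [Metric.mem_ball, Real.dist_eq] at hs)
  have hderiv : ∀ t ∈ Metric.closedBall s₀ |s - s₀|,
      HasDerivWithinAt g (ρ' t - ρ' s₀ - ρ₂ * (t - s₀)) (Metric.closedBall s₀ |s - s₀|) t := by
    intro t ht
    have h2 := (h t (hsub ht)).1
    have h3 : HasDerivAt (fun t : ℝ => t - s₀) 1 t := (hasDerivAt_id t).sub_const s₀
    have h4 := (h2.sub (h3.const_mul (ρ' s₀))).sub ((h3.pow 2).const_mul (ρ₂ / 2))
    refine (h4.congr_deriv ?_).hasDerivWithinAt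
    push_cast
    ring
  have hbound : ∀ t ∈ Metric.closedBall s₀ |s - s₀|,
      ‖ρ' t - ρ' s₀ - ρ₂ * (t - s₀)‖ ≤ ε * |s - s₀| := by
    intro t ht
    have h2 := (h t (hsub ht)).2
    rw [smul_eq_mul, mul_comm (t - s₀)] at h2
    refine h2.trans ?_
    rw [Metric.mem_closedBall, Real.dist_eq] at ht
    rw [Real.norm_eq_abs]
    gcongr
  have h5 := (convex_closedBall s₀ |s - s₀|).norm_image_sub_le_of_norm_hasDerivWithin_le
    hderiv hbound (Metric.mem_closedBall_self (abs_nonneg _))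
    (show s ∈ Metric.closedBall s₀ |s - s₀| by rw [Metric.mem_closedBall, Real.dist_eq])
  rw [Real.norm_eq_abs, Real.norm_eq_abs, mul_assoc, ← pow_two, sq_abs] at h5
  convert h5 using 2
  simp only [hg]
  ring

/-- Testing a Pucci subsolution against a radial function. -/
lemma IsPucciSub.radial {w : En n → ℝ} (hw : IsPucciSub n lam Lam α w) {c x₀ : En n}
    {ρ ρ' : ℝ → ℝ} {ρ₂ : ℝ} (hρ : ∀ᶠ s in 𝓝 (‖x₀ - c‖ ^ 2), HasDerivAt ρ (ρ' s) s)
    (hρ' : HasDerivAt ρ' ρ₂ (‖x₀ - c‖ ^ 2))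
    (htouch : ∀ᶠ y in 𝓝 x₀, w y ≤ w x₀ + (ρ (‖y - c‖ ^ 2) - ρ (‖x₀ - c‖ ^ 2)))
    {μ : ℝ} (hμ : ∀ A ∈ PucciMatrices n lam Lam, μ ≤ -(2 * ρ' (‖x₀ - c‖ ^ 2) * A.trace
      + 4 * ρ₂ * ((x₀ - c).ofLp ⬝ᵥ A *ᵥ (x₀ - c).ofLp))) :
    μ - ρ' (‖x₀ - c‖ ^ 2) * ⟪x₀ - c, x₀⟫ - α * w x₀ ≤ 0 := by
  set s₀ := ‖x₀ - c‖ ^ 2 with hs₀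
  set d := x₀ - c with hd
  have key : ∀ η : ℝ, 0 < η → μ - 4 * η * (n * Lam) - ρ' s₀ * ⟪d, x₀⟫ - α * w x₀ ≤ 0 := by
    intro η hη
    have h := hw x₀ ((2 * ρ' s₀) • d) (radialOp (2 * ρ' s₀ + 4 * η) (4 * ρ₂) d)
      (radialOp_symm _ _ _) η hη ?_ (μ - 4 * η * (n * Lam)) ?_
    · rw [inner_smul_left, conj_trivial] at h
      linarith
    · set ε := η / (2 * (2 * ‖d‖ + 1) ^ 2) with hε
      have hε0 : 0 < ε := by positivity
      have hcont : Continuous fun y : En n => ‖y - c‖ ^ 2 := by fun_prop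
      have h1 := (hcont.tendsto x₀).eventually (eventually_abs_taylor_two_le hρ hρ' hε0)
      have hcont2 : Continuous fun y : En n =>
          |ρ₂| / 2 * (4 * ‖d‖ * ‖y - x₀‖ + ‖y - x₀‖ ^ 2) := by fun_prop
      have h2 := (hcont2.tendsto x₀).eventually_le_const (u := η / 2) (by simpa using by positivity)
      filter_upwards [htouch, h1, h2, Metric.ball_mem_nhds x₀ one_pos] with y hy h1 h2 h3
      rw [mem_ball_iff_norm] at h3
      set e := y - x₀ with he
      have hyc : ‖y - c‖ ^ 2 - s₀ = 2 * ⟪d, e⟫ + ‖e‖ ^ 2 := by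
        rw [show y - c = d + e by rw [hd, he]; abel, norm_add_sq_real, hs₀]
        ring
      rw [hyc] at h1
      have h4 := (abs_le.1 h1).2
      have h5 : |⟪d, e⟫| ≤ ‖d‖ * ‖e‖ := abs_real_inner_le_norm _ _
      have h6 : (2 * ⟪d, e⟫ + ‖e‖ ^ 2) ^ 2 ≤ (2 * ‖d‖ + 1) ^ 2 * ‖e‖ ^ 2 := by
        rw [← mul_pow]
        obtain ⟨h5l, h5u⟩ := abs_le.1 h5
        exact sq_le_sq' (by nlinarith [norm_nonneg e]) (by nlinarith [norm_nonneg e])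
      have h7 : ε * (2 * ⟪d, e⟫ + ‖e‖ ^ 2) ^ 2 ≤ η / 2 * ‖e‖ ^ 2 := by
        refine (mul_le_mul_of_nonneg_left h6 hε0.le).trans (le_of_eq ?_)
        rw [hε]
        field_simp
      have h8 : ρ₂ / 2 * (2 * ⟪d, e⟫ + ‖e‖ ^ 2) ^ 2 ≤ 2 * ρ₂ * ⟪d, e⟫ ^ 2 + η / 2 * ‖e‖ ^ 2 := by
        have h9 : ρ₂ / 2 * (4 * ⟪d, e⟫ + ‖e‖ ^ 2) ≤ η / 2 := by
          refine (le_abs_self _).trans (le_trans ?_ h2)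
          rw [abs_mul, abs_div, abs_two]
          gcongr
          refine (abs_add_le _ _).trans ?_
          rw [abs_mul, abs_of_nonneg (sq_nonneg ‖e‖), abs_of_pos (by norm_num : (0 : ℝ) < 4)]
          linarith
        have h10 := mul_le_mul_of_nonneg_right h9 (sq_nonneg ‖e‖)
        linarith
      have h11 : quadPoly x₀ ((2 * ρ' s₀) • d) (radialOp (2 * ρ' s₀ + 4 * η) (4 * ρ₂) d) y
          = 2 * ρ' s₀ * ⟪d, e⟫ + (ρ' s₀ + 2 * η) * ‖e‖ ^ 2 + 2 * ρ₂ * ⟪d, e⟫ ^ 2 := by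
        simp only [quadPoly, radialOp_apply, ← he, inner_add_left, inner_smul_left, conj_trivial,
          real_inner_self_eq_norm_sq]
        ring
      rw [h11]
      linarith
    · intro A hA
      rw [trace_mul_hessMat_radialOp]
      have h1 := hμ A hA
      have h2 := mul_le_mul_of_nonneg_left (trace_bounds hA).2 (by positivity : 0 ≤ 4 * η)
      linarith
  have hlim : Tendsto (fun η : ℝ => μ - 4 * η * (n * Lam) - ρ' s₀ * ⟪d, x₀⟫ - α * w x₀) (𝓝[>] 0)
      (𝓝 (μ - 4 * 0 * (n * Lam) - ρ' s₀ * ⟪d, x₀⟫ - α * w x₀)) := by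
    have : Continuous fun η : ℝ => μ - 4 * η * (n * Lam) - ρ' s₀ * ⟪d, x₀⟫ - α * w x₀ := by
      fun_prop
    exact (this.tendsto 0).mono_left nhdsWithin_le_nhds
  have := le_of_tendsto hlim (eventually_mem_nhdsWithin.mono fun η hη => key η hη)
  linarith

end Comparison

section MaximumPrinciple

open scoped RealInnerProductSpace

variable {n : ℕ} {lam Lam α : ℝ} {w : En n → ℝ}

/-- The strong maximum principle for Pucci subsolutions. -/
theorem IsPucciSub.eq_zero_of_nonpos (hlam : 0 < lam) (hw : IsPucciSub n lam Lam α w)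
    (hwc : Continuous w) (hw0 : ∀ y, w y ≤ 0) {x : En n} (hx : w x = 0) (y : En n) : w y = 0 := by
  by_contra hy
  have hyneg : w y < 0 := lt_of_le_of_ne (hw0 y) hy
  obtain ⟨c, hc⟩ : ∃ c, c = y := ⟨y, rfl⟩
  rw [← hc] at hyneg
  have hZc : IsClosed {z | w z = 0} := isClosed_eq hwc continuous_const
  obtain ⟨x₁, hx₁, hdist⟩ := hZc.exists_infDist_eq_dist ⟨x, hx⟩ c
  replace hx₁ : w x₁ = 0 := hx₁
  set R := ‖x₁ - c‖ with hR
  have hR0 : 0 < R := by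
    refine norm_pos_iff.2 (sub_ne_zero.2 fun h => ?_)
    rw [h] at hx₁
    linarith
  have hball : ∀ z, ‖z - c‖ < R → w z < 0 := by
    intro z hz
    refine lt_of_le_of_ne (hw0 z) fun h => ?_
    have h1 := Metric.infDist_le_dist_of_mem (x := c) (show z ∈ {z | w z = 0} from h)
    rw [hdist, dist_comm, dist_eq_norm, dist_comm, dist_eq_norm] at h1
    linarith
  obtain ⟨z₀, hz₀, hz₀max⟩ := (isCompact_closedBall c (R / 2)).exists_isMaxOn
    ⟨c, Metric.mem_closedBall_self (by positivity)⟩ hwc.continuousOn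
  have hδ : w z₀ < 0 := hball z₀ (by rw [mem_closedBall_iff_norm] at hz₀; linarith)
  set δ := -w z₀ with hδdef
  have hδ0 : 0 < δ := by linarith
  set K := 2 * (n * Lam) + 2 * R * (2 * R + ‖c‖) with hK
  set β := |K| / (lam * R ^ 2) + |α| / (lam * R ^ 2) + 1 with hβ
  have hlR : 0 < lam * R ^ 2 := by positivity
  have hβ1 : 1 ≤ β := by
    have : 0 ≤ |K| / (lam * R ^ 2) + |α| / (lam * R ^ 2) := by positivity
    linarith
  have hβK : |K| + |α| < β * (lam * R ^ 2) := by
    rw [hβ]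
    field_simp
    linarith
  set φ : En n → ℝ := fun z => -δ * Real.exp (-β * ‖z - c‖ ^ 2) with hφ
  have hφc : Continuous φ := by rw [hφ]; fun_prop
  obtain ⟨y₀, hy₀, hy₀max⟩ := (isCompact_closedBall c (2 * R)).exists_isMaxOn
    ⟨c, Metric.mem_closedBall_self (by positivity)⟩
    (f := fun z => w z - φ z) (hwc.sub hφc).continuousOn
  have hx₁max : w x₁ - φ x₁ ≤ w y₀ - φ y₀ :=
    hy₀max (show x₁ ∈ Metric.closedBall c (2 * R) by rw [mem_closedBall_iff_norm]; linarith)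
  have hφx₁ : φ x₁ = -δ * Real.exp (-β * R ^ 2) := rfl
  rw [hx₁, hφx₁] at hx₁max
  have hinner : R / 2 < ‖y₀ - c‖ := by
    by_contra! hcon
    have h1 : w y₀ ≤ w z₀ := hz₀max (show y₀ ∈ _ by rwa [mem_closedBall_iff_norm])
    have h2 : Real.exp (-β * ‖y₀ - c‖ ^ 2) ≤ 1 := by
      rw [Real.exp_le_one_iff]
      have : 0 ≤ β * ‖y₀ - c‖ ^ 2 := by positivity
      linarith
    have h3 : 0 < δ * Real.exp (-β * R ^ 2) := by positivity
    have h4 := mul_le_mul_of_nonneg_left h2 hδ0.le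
    simp only [hφ] at hx₁max
    linarith
  have houter : ‖y₀ - c‖ < 2 * R := by
    rw [mem_closedBall_iff_norm] at hy₀
    refine lt_of_le_of_ne hy₀ fun h => ?_
    have h1 := hw0 y₀
    simp only [hφ, h] at hx₁max
    have h2 : Real.exp (-β * (2 * R) ^ 2) < Real.exp (-β * R ^ 2) := by
      rw [Real.exp_lt_exp]
      have : 0 < β * R ^ 2 := by positivity
      nlinarith
    have h3 := mul_lt_mul_of_pos_left h2 hδ0
    linarith
  set s₀ := ‖y₀ - c‖ ^ 2 with hs₀
  set ex := Real.exp (-β * s₀) with hex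
  have hex0 : 0 < ex := Real.exp_pos _
  have hexp : ∀ k s : ℝ, HasDerivAt (fun s => k * Real.exp (-β * s))
      (-β * k * Real.exp (-β * s)) s := by
    intro k s
    have h1 := (((hasDerivAt_id s).const_mul (-β)).exp).const_mul k
    refine h1.congr_deriv ?_
    simp only [id_eq]
    ring
  have hmain := hw.radial (c := c) (x₀ := y₀) (ρ := fun s => -δ * Real.exp (-β * s))
    (ρ' := fun s => -β * -δ * Real.exp (-β * s)) (Eventually.of_forall fun s => hexp _ s)
    (hexp _ _) (by
      filter_upwards [Metric.isOpen_ball.mem_nhds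
        (show y₀ ∈ Metric.ball c (2 * R) by rwa [mem_ball_iff_norm])] with z hz
      have : w z - φ z ≤ w y₀ - φ y₀ := hy₀max (Metric.ball_subset_closedBall hz)
      simp only [hφ] at this
      linarith) (μ := δ * ex * (4 * β ^ 2 * lam * s₀ - 2 * β * (n * Lam))) (by
      intro A hA
      have h1 := (dotProduct_mulVec_bounds hA (y₀ - c).ofLp).1
      have h2 := (trace_bounds hA).2
      have h3 : (y₀ - c).ofLp ⬝ᵥ (y₀ - c).ofLp = s₀ := by
        rw [hs₀, EuclideanSpace.real_norm_sq_eq]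
        simp [dotProduct, pow_two]
      rw [h3] at h1
      rw [← hs₀, ← hex]
      have h4 := mul_le_mul_of_nonneg_left h1 (show 0 ≤ 4 * δ * ex * β ^ 2 by positivity)
      have h5 := mul_le_mul_of_nonneg_left h2 (show 0 ≤ 2 * δ * ex * β by positivity)
      linarith)
  rw [← hs₀, ← hex] at hmain
  have hwy₀ : -(|α| * (δ * ex)) ≤ -α * w y₀ := by
    have h1 : |w y₀| ≤ δ * ex := by
      rw [abs_of_nonpos (hw0 y₀)]
      have h2 : 0 < δ * Real.exp (-β * R ^ 2) := by positivity
      simp only [hφ] at hx₁max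
      linarith
    have h3 : |-α * w y₀| ≤ |α| * (δ * ex) := by
      rw [abs_mul, abs_neg]
      gcongr
    exact (abs_le.1 h3).1
  have hinn : ⟪y₀ - c, y₀⟫ ≤ 2 * R * (2 * R + ‖c‖) := by
    refine (real_inner_le_norm _ _).trans ?_
    have : ‖y₀‖ ≤ ‖y₀ - c‖ + ‖c‖ := by
      calc ‖y₀‖ = ‖(y₀ - c) + c‖ := by rw [sub_add_cancel]
        _ ≤ _ := norm_add_le _ _
    gcongr
    linarith
  have hfin : δ * ex * (4 * β ^ 2 * lam * s₀ - β * (2 * (n * Lam) + ⟪y₀ - c, y₀⟫) - |α|) ≤ 0 := by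
    linarith
  have hpos : 0 < 4 * β ^ 2 * lam * s₀ - β * (2 * (n * Lam) + ⟪y₀ - c, y₀⟫) - |α| := by
    have h1 : (R / 2) ^ 2 ≤ s₀ := by rw [hs₀]; gcongr
    have h2 : β * (2 * (n * Lam) + ⟪y₀ - c, y₀⟫) ≤ β * |K| := by
      gcongr
      exact le_trans (by linarith) (le_abs_self K)
    have h3 : 4 * β ^ 2 * lam * (R / 2) ^ 2 ≤ 4 * β ^ 2 * lam * s₀ := by gcongr
    have h4 : β * (|K| + |α|) < β * (β * (lam * R ^ 2)) := by gcongr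
    have h5 : |α| ≤ β * |α| := le_mul_of_one_le_left (abs_nonneg _) hβ1
    linarith
  exact absurd hfin (not_le.2 (by positivity))

lemma tendsto_exp_neg_rpow_mul_pow {C a q : ℝ} (hC : 0 < C) (ha : 0 < a) (hq : 1 < q) (m : ℕ) :
    Tendsto (fun r : ℝ => C * Real.exp (-a * r ^ q) * (1 + r ^ 2) ^ m) atTop (𝓝 0) := by
  have h1 : Tendsto (fun r : ℝ => a * (1 + r)) atTop atTop :=
    (tendsto_atTop_add_const_left _ 1 tendsto_id).const_mul_atTop ha
  have h2 := ((Real.tendsto_pow_mul_exp_neg_atTop_nhds_zero (2 * m)).comp h1).const_mul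
    (C * Real.exp a / a ^ (2 * m))
  rw [mul_zero] at h2
  refine squeeze_zero' ?_ ?_ h2
  · filter_upwards with r
    positivity
  · filter_upwards [eventually_ge_atTop 1] with r hr
    have h3 : r ≤ r ^ q := by
      simpa using Real.rpow_le_rpow_of_exponent_le hr hq.le
    have h4 : (1 + r ^ 2) ^ m ≤ (1 + r) ^ (2 * m) := by
      rw [pow_mul]
      gcongr
      nlinarith
    have h5 : Real.exp (-a * r ^ q) ≤ Real.exp (-a * r) := by
      rw [Real.exp_le_exp]
      nlinarith
    calc C * Real.exp (-a * r ^ q) * (1 + r ^ 2) ^ m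
        ≤ C * Real.exp (-a * r) * (1 + r) ^ (2 * m) := by gcongr
      _ = _ := by
        rw [Function.comp_apply, mul_pow, show -(a * (1 + r)) = -a + -a * r by ring,
          Real.exp_add, Real.exp_neg]
        field_simp

/-- A Pucci subsolution with superexponential decay which is nonpositive on a large enough ball
is nonpositive. The radius of the ball depends only on the equation. -/
theorem exists_radius_nonpos (hlam : 0 < lam) (hLam : lam ≤ Lam) :
    ∃ R : ℝ, 0 < R ∧ ∀ w : En n → ℝ, IsPucciSub n lam Lam α w → Continuous w →
      ∀ C a q : ℝ, 0 < C → 0 < a → 1 < q → (∀ y, w y ≤ C * Real.exp (-a * ‖y‖ ^ q)) →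
      (∀ y ∈ Metric.closedBall (0 : En n) R, w y ≤ 0) → ∀ y, w y ≤ 0 := by
  obtain ⟨m, hm⟩ := exists_nat_ge (|α| + 1)
  have hL0 : 0 < Lam := hlam.trans_le hLam
  set R := 4 * Lam * m * (m + 1) + |α| + 1 with hR
  have hR1 : 1 ≤ R := by
    have : 0 ≤ 4 * Lam * m * (m + 1) + |α| := by positivity
    linarith
  refine ⟨R, by linarith, fun w hw hwc C a q hC ha hq hdecay hball y => ?_⟩
  by_contra! hy
  set G : En n → ℝ := fun z => w z * (1 + ‖z‖ ^ 2) ^ m with hG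
  have hGc : Continuous G := by rw [hG]; fun_prop
  have hGy : 0 < G y := by simp only [hG]; positivity
  have hlim := (tendsto_exp_neg_rpow_mul_pow hC ha hq m).comp (tendsto_norm_cocompact_atTop (E := En n))
  obtain ⟨x₀, hx₀⟩ := hGc.exists_forall_ge' y (by
    filter_upwards [hlim.eventually_le_const hGy] with z hz
    refine le_trans ?_ hz
    simp only [hG, Function.comp_apply]
    gcongr
    exact hdecay z)
  set ε := G x₀ with hε
  have hε0 : 0 < ε := hGy.trans_le (hx₀ y)
  set s₀ := ‖x₀ - 0‖ ^ 2 with hs₀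
  have hs₀nn : 0 ≤ s₀ := by positivity
  have hone : ∀ s : ℝ, 0 ≤ s → (0 : ℝ) < 1 + s := fun s hs => by linarith
  have hle : ∀ z, w z ≤ ε * (1 + ‖z - 0‖ ^ 2) ^ (-(m : ℤ)) := by
    intro z
    have h1 : G z ≤ ε := hx₀ z
    rw [sub_zero, _root_.zpow_neg, zpow_natCast, ← div_eq_mul_inv, le_div_iff₀ (by positivity)]
    exact h1
  have hwx₀ : w x₀ = ε * (1 + s₀) ^ (-(m : ℤ)) := by
    rw [hs₀, sub_zero, _root_.zpow_neg, zpow_natCast, hε, hG]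
    field_simp
  have hderiv : ∀ (k : ℝ) (j : ℤ) (s : ℝ), 0 < 1 + s →
      HasDerivAt (fun s => k * (1 + s) ^ j) (k * j * (1 + s) ^ (j - 1)) s := by
    intro k j s hs
    have h1 := ((hasDerivAt_zpow j (1 + s) (Or.inl hs.ne')).comp s
      ((hasDerivAt_id s).const_add 1)).const_mul k
    refine h1.congr_deriv ?_
    ring
  set P := (1 + s₀) ^ (-(m : ℤ) - 1 - 1) with hP
  have hP0 : 0 < P := zpow_pos (hone s₀ hs₀nn) _
  have hP1 : (1 + s₀) ^ (-(m : ℤ) - 1) = P * (1 + s₀) := by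
    rw [hP, ← zpow_add_one₀ (hone s₀ hs₀nn).ne', sub_add_cancel]
  have hP2 : (1 + s₀) ^ (-(m : ℤ)) = P * (1 + s₀) ^ 2 := by
    rw [pow_two, ← mul_assoc, ← hP1, ← zpow_add_one₀ (hone s₀ hs₀nn).ne', sub_add_cancel]
  have hmain := hw.radial (c := 0) (x₀ := x₀) (ρ := fun s => ε * (1 + s) ^ (-(m : ℤ)))
    (ρ' := fun s => ε * (-(m : ℤ) : ℤ) * (1 + s) ^ (-(m : ℤ) - 1))
    (by
      filter_upwards [lt_mem_nhds (show -1 < ‖x₀ - 0‖ ^ 2 by linarith)] with s hs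
      exact hderiv _ _ s (by linarith))
    (hderiv _ _ _ (hone _ hs₀nn))
    (Eventually.of_forall fun z => by rw [hwx₀, ← hs₀]; linarith [hle z])
    (μ := -(4 * (ε * m * (m + 1) * P) * (Lam * s₀))) (by
      intro A hA
      have h1 := (dotProduct_mulVec_bounds hA (x₀ - 0).ofLp).2
      have h2 : 0 ≤ A.trace := le_trans (by positivity) (trace_bounds hA).1
      have h3 : (x₀ - 0).ofLp ⬝ᵥ (x₀ - 0).ofLp = s₀ := by
        rw [hs₀, EuclideanSpace.real_norm_sq_eq]
        simp [dotProduct, pow_two]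
      rw [h3] at h1
      rw [← hs₀, ← hP, hP1]
      push_cast
      have h4 := mul_le_mul_of_nonneg_left h1 (show 0 ≤ 4 * (ε * m * (m + 1) * P) by positivity)
      have h5 : 0 ≤ 2 * (ε * m * (P * (1 + s₀))) * A.trace := by positivity
      linarith)
  have hinn : ⟪x₀ - 0, x₀⟫ = s₀ := by rw [hs₀, sub_zero, real_inner_self_eq_norm_sq]
  rw [← hs₀, hP1, hinn, hwx₀, hP2] at hmain
  push_cast at hmain
  have hfin : ε * P * (m * s₀ * (1 + s₀) - 4 * m * (m + 1) * Lam * s₀ - α * (1 + s₀) ^ 2) ≤ 0 := by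
    linarith
  have hx₀R : R < s₀ := by
    have h1 : R < ‖x₀‖ := by
      by_contra! hcon
      have h2 := hball x₀ (by rwa [mem_closedBall_zero_iff])
      rw [hwx₀, hP2] at h2
      have : 0 < ε * (P * (1 + s₀) ^ 2) := by positivity
      linarith
    rw [hs₀, sub_zero]
    nlinarith
  have hpos : 0 < m * s₀ * (1 + s₀) - 4 * m * (m + 1) * Lam * s₀ - α * (1 + s₀) ^ 2 := by
    have h1 : α ≤ |α| := le_abs_self α
    have h2 : α * (1 + s₀) ^ 2 ≤ |α| * (1 + s₀) ^ 2 := by gcongr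
    have h3 : (|α| + 1) * (s₀ * (1 + s₀)) ≤ m * (s₀ * (1 + s₀)) := by gcongr
    have h4 : (4 * Lam * m * (m + 1)) * (1 + s₀) < (s₀ - |α|) * (1 + s₀) := by
      gcongr
      linarith
    have h5 : 0 ≤ 4 * Lam * m * (m + 1) := by positivity
    linarith
  exact absurd hfin (not_le.2 (by positivity))

end MaximumPrinciple

/-- **Lemma 3.2.** Half-eigenvalue comparison: if `F(D²u) - (1/2)y·Du - αu ≤ f` and
`f ≤ F(D²v) - (1/2)y·Dv - αv` in `ℝⁿ` with `f ≥ 0`, `v > 0`, and `u` has superexponential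
decay, then either `u ≤ v` in `ℝⁿ` or `u ≡ t v` for some `t > 1`. -/
theorem parabolic_HCP (n : ℕ) (hn : 1 ≤ n) (lam Lam : ℝ) (hlam : 0 < lam) (hLam : lam ≤ Lam)
    (F : Mat n → ℝ) (hF : UniformlyElliptic n lam Lam F) (hFh : PositivelyHomogeneous n F)
    (u v f : En n → ℝ) (α : ℝ)
    (hu : Continuous u) (hv : Continuous v) (hf : Continuous f) (hf0 : ∀ y, 0 ≤ f y)
    (hsub : ViscSubE n Set.univ (Fop n F α f) u)
    (hsup : ViscSupE n Set.univ (Fop n F α f) v)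
    (hvpos : ∀ y, 0 < v y)
    (C a q : ℝ) (hC : 0 < C) (ha : 0 < a) (hq : 1 < q)
    (hdecay : ∀ y : En n, u y ≤ C * Real.exp (-a * ‖y‖ ^ q)) :
    (∀ y, u y ≤ v y) ∨ ∃ t : ℝ, 1 < t ∧ ∀ y, u y = t * v y := by
  obtain ⟨R, hR, hext⟩ := exists_radius_nonpos (n := n) (α := α) hlam hLam
  have hCu (y : En n) : u y ≤ C := by
    have h : Real.exp (-a * ‖y‖ ^ q) ≤ 1 :=
      Real.exp_le_one_iff.2 (by have := Real.rpow_nonneg (norm_nonneg y) q; nlinarith)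
    exact (hdecay y).trans (by nlinarith)
  have hPucci {t : ℝ} (ht : 1 ≤ t) : IsPucciSub n lam Lam α fun y => u y - t * v y :=
    isPucciSub_sub hLam hF hu (continuous_const.mul hv) hf hCu
      (fun y => mul_nonneg (by linarith) (hvpos y).le)
      (fun y q T hT h => hsub.le_of_jet hT h)
      (fun y q T hT h => hsup.le_of_jet_mul hFh hf0 ht hT h)
  have hle {t : ℝ} (ht : 1 ≤ t) (hball : ∀ y ∈ Metric.closedBall (0 : En n) R, u y ≤ t * v y)
      (y : En n) : u y - t * v y ≤ 0 := by
    refine hext _ (hPucci ht) (by fun_prop) C a q hC ha hq (fun z => ?_)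
      (fun z hz => sub_nonpos.2 (hball z hz)) y
    have : 0 ≤ t * v z := mul_nonneg (by linarith) (hvpos z).le
    linarith [hdecay z]
  obtain ⟨y₀, -, hmax⟩ := (isCompact_closedBall (0 : En n) R).exists_isMaxOn
    ⟨0, Metric.mem_closedBall_self hR.le⟩
    (hu.div hv fun y => (hvpos y).ne').continuousOn
  have hball : ∀ y ∈ Metric.closedBall (0 : En n) R, u y ≤ u y₀ / v y₀ * v y := fun y hy =>
    (div_le_iff₀ (hvpos y)).1 (hmax hy)
  rcases le_or_gt (u y₀ / v y₀) 1 with hm | hm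
  · refine Or.inl fun y => ?_
    have h := hle le_rfl (fun z hz => (hball z hz).trans
      (mul_le_mul_of_nonneg_right hm (hvpos z).le)) y
    linarith
  · refine Or.inr ⟨_, hm, fun y => ?_⟩
    have hzero : u y₀ - u y₀ / v y₀ * v y₀ = 0 := by
      rw [div_mul_cancel₀ _ (hvpos y₀).ne', sub_self]
    exact sub_eq_zero.1 ((hPucci hm.le).eq_zero_of_nonpos hlam (by fun_prop) (hle hm.le hball)
      hzero y)
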